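/- There exists an absolute constant C₀ > 0 such that for all β ≥ 1 the following holds. Let {(γ_s, h_s)}_{s ∈ S} be a finite family of contours in Λ = {1,…,L}² with integer heights h_s ≥ 1 such that for every i ≥ 1 one has ∪_{s : h_s = i+1} Λ_{γ_s} ⊆ ∪_{s : h_s = i} Λ_{γ_s}, and Λ_{γ_s} ∩ Λ_{γ_{s'}} = ∅ whenever h_s = h_{s'} and s ≠ s'. Then π_Λ^0( ∩_{s ∈ S} C_{γ_s, h_s} ) ≤ exp( Σ_{s ∈ S} ( −β|γ_s| + C₀·|Λ_{γ_s}|·e^{−4βh_s} ) ), where π_Λ^0 is the SOS Gibbs measure with zero boundary conditions, floor at 0 and ceiling at n⁺ with log L ≤ n⁺ ≤ L. -/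

import Mathlib

open scoped Classical
open Filter

noncomputable section

namespace SOSPaper

/-- Sites of the lattice `ℤ²`. -/
abbrev Site : Type := ℤ × ℤ

/-- Height configurations on `ℤ²`. -/
abbrev Config : Type := Site → ℤ

/-- Nearest-neighbour adjacency on `ℤ²`. -/
def SiteAdj (x y : Site) : Prop := (x.1 - y.1).natAbs + (x.2 - y.2).natAbs = 1

/-- The four nearest neighbours of a site. -/
def nbrs (x : Site) : Finset Site :=
  {(x.1 + 1, x.2), (x.1 - 1, x.2), (x.1, x.2 + 1), (x.1, x.2 - 1)}

/-- The SOS Hamiltonian on `Λ` with boundary condition `ξ`: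
`H_Λ^ξ(η) = (1/2) Σ_{x,y∈Λ adjacent} |η_x-η_y| + Σ_{x∈Λ, y∉Λ adjacent} |η_x-ξ_y|`. -/
def sosH (Λ : Finset Site) (ξ : Config) (η : Config) : ℝ :=
  (1 / 2) * ∑ x ∈ Λ, ∑ y ∈ (nbrs x).filter (fun y => y ∈ Λ), ((|η x - η y| : ℤ) : ℝ)
    + ∑ x ∈ Λ, ∑ y ∈ (nbrs x).filter (fun y => y ∉ Λ), ((|η x - ξ y| : ℤ) : ℝ)

/-- Extension of `g : Λ → ℤ` by the boundary condition `ξ` off `Λ`. -/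
def extendC (Λ : Finset Site) (ξ : Config) (g : {x // x ∈ Λ} → ℤ) : Config :=
  fun x => if h : x ∈ Λ then g ⟨x, h⟩ else ξ x

/-- Gibbs weight `exp(-β·H_Λ^ξ(η) + F(η))`, subject to the single-site constraint
`η_x ∈ K` for all `x ∈ Λ` (floor/ceiling constraints); `F` is an extra external field
(`F = 0` for the plain SOS model). -/
def gWeight (β : ℝ) (Λ : Finset Site) (ξ : Config) (K : Set ℤ) (F : Config → ℝ)
    (η : Config) : ℝ :=
  if ∀ x ∈ Λ, η x ∈ K then Real.exp (-β * sosH Λ ξ η + F η) else 0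

/-- The Gibbs probability of a set `A` of configurations: normalized sum of Gibbs
weights over all configurations agreeing with `ξ` off `Λ`. -/
def gProb (β : ℝ) (Λ : Finset Site) (ξ : Config) (K : Set ℤ) (F : Config → ℝ)
    (A : Set Config) : ℝ :=
  (∑' g : {x // x ∈ Λ} → ℤ, Set.indicator A (gWeight β Λ ξ K F) (extendC Λ ξ g))
    / ∑' g : {x // x ∈ Λ} → ℤ, gWeight β Λ ξ K F (extendC Λ ξ g)

/-- The box `Λ_L = {1,…,L}²`. -/
def box (L : ℕ) : Finset Site := Finset.Icc ((1 : ℤ), (1 : ℤ)) ((L : ℤ), (L : ℤ))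

/-- The equilibrium height `H(L) = ⌊log L / (4β)⌋`. -/
def eqHt (β : ℝ) (L : ℕ) : ℤ := ⌊Real.log L / (4 * β)⌋

/-- A dual vertex `d` represents the point `(d₁ + 1/2, d₂ + 1/2)` of the dual lattice `(ℤ²)*`. -/
abbrev DualV : Type := ℤ × ℤ

/-- The `i`-th dual vertex of the closed circuit described by the list `l`
(indices taken cyclically). -/
def cVert (l : List DualV) (i : ℕ) : DualV := l.getD (i % l.length) (0, 0)

/-- The `i`-th bond of the circuit: the pair of consecutive dual vertices. -/
def cEdge (l : List DualV) (i : ℕ) : DualV × DualV := (cVert l i, cVert l (i + 1))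

/-- The length `|γ|` of the contour (number of its bonds). -/
def cLen (l : List DualV) : ℕ := l.length

/-- The pair of bonds of the circuit meeting at the `i`-th vertex is a *linked pair*:
both bonds lie on the same side of the forty-five degrees line through that vertex. -/
def linkedAt (l : List DualV) (i : ℕ) : Prop :=
  0 < ((cVert l (i + l.length - 1)).2 - (cVert l i).2
        - ((cVert l (i + l.length - 1)).1 - (cVert l i).1))
      * ((cVert l (i + 1)).2 - (cVert l i).2 - ((cVert l (i + 1)).1 - (cVert l i).1))

/-- `l` describes a geometric contour: a closed circuit of pairwise distinct dual bonds,
consecutive bonds sharing a vertex, obeying the splitting rule: whenever two pairs of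
consecutive bonds of `γ` meet at a dual vertex, both pairs are linked. -/
def IsContour (l : List DualV) : Prop :=
  l ≠ [] ∧
  (∀ i < l.length, SiteAdj (cVert l i) (cVert l (i + 1))) ∧
  (∀ i < l.length, ∀ j < l.length, i ≠ j →
      cEdge l i ≠ cEdge l j ∧ cEdge l i ≠ ((cEdge l j).2, (cEdge l j).1)) ∧
  (∀ i < l.length, ∀ j < l.length, i ≠ j → cVert l i = cVert l j →
      linkedAt l i ∧ linkedAt l j)

/-- The dual bond `e` crosses the horizontal ray going right from the site `x`:
`e` is a vertical dual bond at height `x₂ − 1/2 … x₂ + 1/2` to the right of `x`. -/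
def crossesRay (x : Site) (e : DualV × DualV) : Prop :=
  (e.2 = (e.1.1, e.1.2 + 1) ∧ e.1.2 = x.2 - 1 ∧ x.1 ≤ e.1.1) ∨
  (e.1 = (e.2.1, e.2.2 + 1) ∧ e.2.2 = x.2 - 1 ∧ x.1 ≤ e.2.1)

/-- The site `x` belongs to the interior `Λ_γ` of the contour: the ray from `x`
to the right crosses the contour an odd number of times. -/
def inContour (l : List DualV) (x : Site) : Prop :=
  Odd ((Finset.range l.length).filter (fun i => crossesRay x (cEdge l i))).card

/-- A bounding box containing the contour's interior. -/
def cBBox (l : List DualV) : Finset Site :=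
  Finset.Icc (((l.map Prod.fst).foldr min 0) - 2, ((l.map Prod.snd).foldr min 0) - 2)
             (((l.map Prod.fst).foldr max 0) + 2, ((l.map Prod.snd).foldr max 0) + 2)

/-- The interior area `|Λ_γ|` of the contour. -/
def cArea (l : List DualV) : ℕ := ((cBBox l).filter (fun x => inContour l x)).card

/-- The (at most two) sites of `ℤ²` at Euclidean distance `1/2` from the dual bond `e`,
i.e. the endpoints of the primal edge crossed by `e`. -/
def edgeSites (e : DualV × DualV) : Set Site :=
  {x | (e.2 = (e.1.1, e.1.2 + 1) ∧ (x = (e.1.1, e.1.2 + 1) ∨ x = (e.1.1 + 1, e.1.2 + 1))) ∨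
       (e.1 = (e.2.1, e.2.2 + 1) ∧ (x = (e.2.1, e.2.2 + 1) ∨ x = (e.2.1 + 1, e.2.2 + 1))) ∨
       (e.2 = (e.1.1 + 1, e.1.2) ∧ (x = (e.1.1 + 1, e.1.2) ∨ x = (e.1.1 + 1, e.1.2 + 1))) ∨
       (e.1 = (e.2.1 + 1, e.2.2) ∧ (x = (e.2.1 + 1, e.2.2) ∨ x = (e.2.1 + 1, e.2.2 + 1)))}

/-- The direction of the bond `e` as seen from its endpoint `d`. -/
def dirFrom (d : DualV) (e : DualV × DualV) : ℤ × ℤ := if e.1 = d then e.2 - d else e.1 - d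

/-- The dual vertex `d` is a meeting point of two non-linked bonds of the contour. -/
def nonLinkedMeet (l : List DualV) (d : DualV) : Prop :=
  ∃ i < l.length, ∃ j < l.length,
    ((cEdge l i).1 = d ∨ (cEdge l i).2 = d) ∧ ((cEdge l j).1 = d ∨ (cEdge l j).2 = d) ∧
    cEdge l i ≠ cEdge l j ∧ cEdge l i ≠ ((cEdge l j).2, (cEdge l j).1) ∧
    ((dirFrom d (cEdge l i)).2 - (dirFrom d (cEdge l i)).1) *
      ((dirFrom d (cEdge l j)).2 - (dirFrom d (cEdge l j)).1) < 0

/-- `Δ_γ`: sites at distance `1/2` from `γ`, together with sites at distance `1/√2`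
from a dual vertex where two non-linked bonds of `γ` meet. -/
def cDelta (l : List DualV) : Set Site :=
  {x | (∃ i < l.length, x ∈ edgeSites (cEdge l i)) ∨
       (∃ d : DualV, nonLinkedMeet l d ∧
          (x = d ∨ x = (d.1 + 1, d.2) ∨ x = (d.1, d.2 + 1) ∨ x = (d.1 + 1, d.2 + 1)))}

/-- `Δ_γ⁺ = Δ_γ ∩ Λ_γ`. -/
def cDeltaPlus (l : List DualV) : Set Site := {x ∈ cDelta l | inContour l x}

/-- `Δ_γ⁻ = Δ_γ \ Λ_γ`. -/
def cDeltaMinus (l : List DualV) : Set Site := {x ∈ cDelta l | ¬ inContour l x}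

/-- The event `C_{γ,h}` that `γ` is an `h`-contour for the configuration:
`η ≤ h−1` on `Δ_γ⁻` and `η ≥ h` on `Δ_γ⁺`. -/
def hContourEvent (l : List DualV) (h : ℤ) : Set Config :=
  {η | (∀ x ∈ cDeltaMinus l, η x ≤ h - 1) ∧ (∀ x ∈ cDeltaPlus l, h ≤ η x)}

/-! ### Part 1: counting self-avoiding walks -/

/-- The four unit directions. -/
def dirs : Finset Site := {(1, 0), (0, 1), (-1, 0), (0, -1)}

/-- The automaton table: (occupied positions, weight, transitions), packed. -/
def tab : List (ℕ × ℕ × ℕ) :=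
[(0x78, 32000, 0xd000009000), (0x7877, 27481, 0x1c000009010),
 (0x786867, 26976, 0x34000009000), (0x877877, 20225, 0x9008),
 (0x87776757, 15187, 0x50040048), (0x87797877, 9985, 0x71078),
 (0x87776867, 13827, 0xb10a10a8), (0x8777675747, 15064, 0xc8040048),
 (0x8786766656, 16136, 0xe10d10d8), (0x7877675747, 16214, 0xfc0000f00e8),
 (0x9897877767, 8923, 0x102109000), (0x7868585756, 16968, 0x114000020080),
 (0x8777696867, 12133, 0x131121128), (0x8777766656, 15809, 0x161151158),
 (0x8778776867, 11743, 0xa10a8), (0x7877696867, 15391, 0x17c000030170),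
 (0x7868584847, 17443, 0x18c000038180), (0x8777675857, 14270, 0x198190048),
 (0x7868676656, 16420, 0x640001a1058), (0x8979787767, 9720, 0x1bd0000001c0),
 (0x7876686766, 15664, 0x1d40001c9058), (0x7877675857, 16248, 0x1e40000681d8),
 (0x8987797877, 5664, 0x78), (0x8777676656, 15561, 0x990911e8),
 (0x786858483828, 17541, 0x3c0000380c0), (0x989787776757, 8586, 0x50258000),
 (0x786858575655, 16876, 0x260000020080), (0x787776665646, 15522, 0x98000119090),
 (0x897969686766, 11453, 0x26c27100012c), (0x786867574737, 16957, 0x14c000140138),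
 (0x877776665646, 15717, 0x278151158), (0x877877685848, 11389, 0x168280),
 (0x978778776867, 9586, 0x2891e0), (0x797869686766, 14661, 0x64000178290),
 (0x877767595857, 13481, 0x2a82982a0), (0x787767575655, 16042, 0x2b00000681a8),
 (0x867876686766, 13483, 0x2c00001c92b8), (0x787767595857, 15912, 0x1e40002c81d8),
 (0x978987797877, 3577, 0x9c), (0x786858574737, 17258, 0x8c000020080),
 (0x877767665646, 15419, 0x2d00911e8), (0x877768675848, 13404, 0x2001f01f8),
 (0x786867575655, 16729, 0x2d80000b8208), (0x787767665646, 16090, 0x228000221218),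
 (0x897978686766, 10143, 0x640000002e0), (0x878677766757, 14901, 0x500402e8),
 (0x786867595857, 16517, 0x24c000088240), (0x877877686766, 11483, 0x2f9300),
 (0x786858483837, 17541, 0x3c0000380c0), (0x877767574847, 14799, 0x308040048),
 (0x878676665756, 15594, 0x3110d10d8), (0x989787776867, 6971, 0x202319000),
 (0x787776665655, 15522, 0x98000119090), (0x786867574746, 16957, 0x14c000140138),
 (0x897978685857, 11121, 0x8c000000320), (0x878678776867, 11195, 0x331328),
 (0x797869686757, 15219, 0x33c000178174), (0x787776665756, 15522, 0x98000119090),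
 (0x877977696867, 10079, 0x348340128), (0x786867574847, 16957, 0x14c000140138),
 (0x877877685857, 11389, 0x168350), (0x787767575646, 16149, 0x1b00000681a8),
 (0x878676676657, 15281, 0x3613591c8), (0x787767585748, 16108, 0x1e40003681d8),
 (0x989787787768, 5037, 0x371000), (0x786858574746, 17258, 0x8c000020080),
 (0x897969685857, 13404, 0x1f42040001fc), (0x786867575646, 17009, 0x2100000b8208),
 (0x787767665655, 16090, 0x228000221218), (0x897978686757, 10627, 0x37c000000230),
 (0x797869685857, 15722, 0x8c000070388), (0x786867665857, 16297, 0x64000020058),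
 (0x786858574847, 17213, 0x8c000038080), (0x877768675857, 13404, 0x2001f01f8),
 (0x787767665756, 15987, 0x228000068218), (0x97968786766656, 14411, 0xe1291179),
 (0x89796959585756, 13231, 0x29c3900002a4), (0x87867669686766, 12256, 0x3a13991c8),
 (0x99989789877767, 2955, 0x3aa000000), (0x98978786766656, 9893, 0xe12e1000),
 (0x78776867584838, 16050, 0x740000382f0), (0x78777669686766, 14662, 0x98000030238),
 (0x78696859585756, 16227, 0x114000248244), (0x87867666585756, 14863, 0x3b10d10d8),
 (0x78776757494847, 16042, 0xfc0003b80e8), (0x98978777696867, 5731, 0x1313c1000),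
 (0x89797868585756, 10831, 0x114000000320), (0x78766866585756, 15717, 0x3cc000020080),
 (0x89877977696867, 5401, 0x3480003d0), (0x87777666585756, 14897, 0x3d9151158),
 (0x98978777766656, 9333, 0x1611c1000), (0x89796968585756, 12643, 0x3e43e80001fc),
 (0x79786968585756, 15431, 0x114000070388), (0x78777667665747, 15436, 0x98000068090),
 (0x78686758574838, 16809, 0x24c000038240), (0x78777668676656, 15285, 0x980001c9238),
 (0x78776867585756, 15920, 0x1b00000201d8), (0x98978777675857, 7868, 0x198258000),
 (0x89797669686766, 9979, 0x3f43f900012c), (0x79787669686766, 13905, 0x1d4000178290),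
 (0x79786968584847, 15952, 0x18c0000702f4), (0x78777668675857, 15260, 0x2c000020238),
 (0x78777668676658, 15162, 0x98000020238), (0x87777668676658, 13359, 0x2001f0250),
 (0x87867876686766, 11424, 0x1c91c8), (0x98978987797877, 55, 0x0),
 (0x78776867584847, 16050, 0x740000382f0), (0x78686665585756, 16688, 0x400000020080),
 (0x89797776696867, 9316, 0x40c34c000410), (0x87777666575647, 15428, 0x418151158),
 (0x79787776696867, 13688, 0x2c000178420), (0x87867776686758, 13157, 0x2001f0380),
 (0x78777667665857, 15436, 0x98000068090), (0x78696859584847, 16712, 0x18c000248244),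
 (0x9998897969686766, 5051, 0x42d271000000), (0x8678766866585756, 14187, 0x430000020080),
 (0x9789877977696867, 3597, 0x34800009c), (0x9787797877696867, 8030, 0x1b822c),
 (0x8986797669686766, 7993, 0x43c3f9000440), (0x8777766656484746, 15248, 0x448151158),
 (0x8679787669686766, 11996, 0x2c00001782b8), (0x8779776967595857, 10082, 0x4584502a0),
 (0x7978776967595857, 14622, 0x1e40001e01d8), (0x8986797876686766, 7666, 0x2c00000002e0),
 (0x8786766766595857, 14384, 0x4613591c8), (0x9998897978686766, 3865, 0x46d000000000),
 (0x8786797669686766, 9890, 0x4594511c8), (0x9998978987776867, 1317, 0x133000000),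
 (0x8979696766595857, 12721, 0x29c4700002a4), (0x8786797876686766, 9903, 0x1e11c8),
 (0x7978696766595857, 15359, 0x47c0001e01dc), (0x9897878676676657, 9107, 0x3612e1000),
 (0x7869686766595857, 15731, 0x64000248240), (0x968679787669686766, 10770, 0x3a0000178398),
 (0x898779776967595857, 5923, 0x4580002a0), (0x898786797669686766, 5504, 0x459000440),
 (0x797876696659585756, 14902, 0x4840001e01dc), (0x989787867666585756, 8620, 0x3b12e1000),
 (0x878678766866585756, 11300, 0x200d8), (0x989789877977696867, 55, 0x348000000),
 (0x968986797776696867, 6880, 0x48c34c000410), (0x968679787776696867, 10503, 0x130000178120),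
 (0x999889797776696867, 3664, 0x40c34c000000), (0x877776696866585756, 13393, 0x491151158),
 (0x87797776696659585756, 12151, 0x4980d0158), (0x99898786797876686766, 3284, 0x51),
 (0x97898786797876686766, 3577, 0x9c), (0x9897898786797669686766, 55, 0x459000000)]

/-- Unpack a list of occupied positions. -/
def occL : ℕ → ℕ → List (ℤ × ℤ)
  | 0, _ => []
  | f + 1, n => bif Nat.beq n 0 then [] else
      (((n % 256 / 16 : ℕ) : ℤ) - 8, ((n % 16 : ℕ) : ℤ) - 8) :: occL f (n / 256)

/-- Occupied positions of a state. -/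
def occ (st : ℕ × ℕ × ℕ) : List (ℤ × ℤ) := occL 30 st.1

/-- Symmetries of the square. -/
def symA (a : ℕ) (p : ℤ × ℤ) : ℤ × ℤ :=
  (bif Nat.beq (a / 2 % 2) 1 then -(bif Nat.beq (a % 2) 1 then p.2 else p.1)
     else (bif Nat.beq (a % 2) 1 then p.2 else p.1),
   bif Nat.beq (a / 4 % 2) 1 then -(bif Nat.beq (a % 2) 1 then p.1 else p.2)
     else (bif Nat.beq (a % 2) 1 then p.1 else p.2))

/-- Membership test. -/
def memB (p : ℤ × ℤ) : List (ℤ × ℤ) → Bool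
  | [] => false
  | q :: l => (decide (p.1 = q.1) && decide (p.2 = q.2)) || memB p l

/-- Contribution of direction `d` (number `k`). -/
def contrib (st : ℕ × ℕ × ℕ) (k : ℕ) (d : ℤ × ℤ) : Option ℕ :=
  bif memB d (occ st) then some 0 else
    match tab[(st.2.2 / 4096 ^ k) % 4096 / 8]? with
    | none => none
    | some st' =>
      bif (occ st').all (fun o =>
        memB (d.1 + (symA (st.2.2 / 4096 ^ k % 8) o).1, d.2 + (symA (st.2.2 / 4096 ^ k % 8) o).2)
          ((0, 0) :: occ st))
      then some st'.2.1 else none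

/-- Verification of a state. -/
def stOK (st : ℕ × ℕ × ℕ) : Bool :=
  match contrib st 0 (1, 0), contrib st 1 (0, 1), contrib st 2 (-1, 0), contrib st 3 (0, -1) with
  | some a, some b, some c, some e =>
      Nat.ble 1 st.2.1 && Nat.ble (1000 * (a + b + c + e)) (2718 * st.2.1)
  | _, _, _, _ => false

theorem tab_ok : tab.all stOK = true := by
  decide +kernel

theorem memB_iff (p : ℤ × ℤ) (l : List (ℤ × ℤ)) : memB p l = true ↔ p ∈ l := by
  induction l with
  | nil => simp [memB]
  | cons q l ih => simp [memB, ih, Prod.ext_iff]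

theorem symA_add (a : ℕ) (p q : ℤ × ℤ) : symA a (p + q) = symA a p + symA a q := by
  unfold symA
  cases Nat.beq (a / 2 % 2) 1 <;> cases Nat.beq (a / 4 % 2) 1 <;> cases Nat.beq (a % 2) 1 <;>
    (ext <;> simp <;> ring)

theorem symA_dirs (a : ℕ) : dirs.image (symA a) = dirs := by
  unfold symA dirs
  cases Nat.beq (a / 2 % 2) 1 <;> cases Nat.beq (a / 4 % 2) 1 <;> cases Nat.beq (a % 2) 1 <;>
    (simp; try decide)

/-- Self-avoiding extensions of length `k` from `v` avoiding `h`. -/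
def ext : ℕ → Site → List Site → Finset (List Site)
  | 0, _, _ => {[]}
  | k + 1, v, h => dirs.biUnion (fun d => if v + d ∈ h then ∅ else
      (ext k (v + d) ((v + d) :: h)).image (List.cons (v + d)))

theorem ext_card (k : ℕ) : ∀ (v : Site) (h : List Site) (st : ℕ × ℕ × ℕ) (A : Site → Site),
    st ∈ tab → (∀ x y, A (x + y) = A x + A y) → dirs.image A = dirs → v ∈ h →
    (∀ o ∈ occ st, v + A o ∈ h) → (ext k v h).card * 1000 ^ k ≤ st.2.1 * 2718 ^ k := by
  induction k with
  | zero =>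
    intro v h st A hst _ _ _ _
    have := List.all_eq_true.1 tab_ok st hst
    unfold stOK at this
    split at this
    · simp only [Bool.and_eq_true, Nat.ble_eq] at this
      simpa [ext] using this.1
    · simp at this
  | succ k ih =>
    intro v h st A hst hA hD hv ho
    have hA0 : A 0 = 0 := by simpa using hA 0 0
    have key : ∀ j d a, contrib st j d = some a →
        (if v + A d ∈ h then ∅ else
          (ext k (v + A d) ((v + A d) :: h)).image (List.cons (v + A d))).card * 1000 ^ k
          ≤ a * 2718 ^ k := by
      intro j d a hc
      by_cases hm : v + A d ∈ h
      · simp [hm]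
      · rw [if_neg hm]
        refine le_trans (Nat.mul_le_mul_right _ Finset.card_image_le) ?_
        have hd : memB d (occ st) = false := by
          by_contra hb
          rw [Bool.not_eq_false, memB_iff] at hb
          exact hm (ho d hb)
        unfold contrib at hc
        rw [hd, cond_false] at hc
        split at hc
        · simp at hc
        · rename_i st' hst'
          rcases hb : (occ st').all (fun o =>
            memB (d.1 + (symA (st.2.2 / 4096 ^ j % 8) o).1,
              d.2 + (symA (st.2.2 / 4096 ^ j % 8) o).2)
              ((0, 0) :: occ st)) with _ | _
          · rw [hb] at hc; simp at hc
          · rw [hb, cond_true] at hc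
            obtain rfl : st'.2.1 = a := by simpa using hc
            set s := st.2.2 / 4096 ^ j % 8
            refine ih _ _ st' (fun x => A (symA s x)) (List.mem_of_getElem? hst') ?_ ?_ ?_ ?_
            · intro x y
              rw [symA_add, hA]
            · have : dirs.image (fun x => A (symA s x)) = (dirs.image (symA s)).image A := by
                rw [Finset.image_image]; rfl
              rw [this, symA_dirs, hD]
            · simp
            · intro o hos
              have h1 := List.all_eq_true.1 hb o hos
              rw [memB_iff] at h1
              have h2 : v + A d + A (symA s o) = v + A (d + symA s o) := by
                rw [hA, add_assoc]
              rw [h2]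
              have h3 : d + symA s o = (d.1 + (symA s o).1, d.2 + (symA s o).2) := rfl
              rw [h3]
              rcases List.mem_cons.1 h1 with h4 | h4
              · rw [h4]
                have : A (0, 0) = 0 := hA0
                rw [this, add_zero]
                exact List.mem_cons_of_mem _ hv
              · exact List.mem_cons_of_mem _ (ho _ h4)
    have := List.all_eq_true.1 tab_ok st hst
    unfold stOK at this
    split at this
    · rename_i a b c e h1 h2 h3 h4
      simp only [Bool.and_eq_true, Nat.ble_eq] at this
      have hle : (ext (k + 1) v h).card ≤ ∑ d ∈ dirs, (if v + d ∈ h then ∅ else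
          (ext k (v + d) ((v + d) :: h)).image (List.cons (v + d))).card := by
        rw [ext]; exact Finset.card_biUnion_le
      have hinj : Set.InjOn A (dirs : Set Site) := by
        apply Finset.card_image_iff.1
        rw [hD]
      have hsum : ∑ d ∈ dirs, (if v + d ∈ h then ∅ else
          (ext k (v + d) ((v + d) :: h)).image (List.cons (v + d))).card =
          ∑ d ∈ dirs, (if v + A d ∈ h then ∅ else
          (ext k (v + A d) ((v + A d) :: h)).image (List.cons (v + A d))).card := by
        conv_lhs => rw [← hD]
        rw [Finset.sum_image hinj]
      have e1 := key _ _ _ h1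
      have e2 := key _ _ _ h2
      have e3 := key _ _ _ h3
      have e4 := key _ _ _ h4
      rw [hsum] at hle
      have hd4 : ∀ f : Site → ℕ, ∑ d ∈ dirs, f d =
          f (1, 0) + f (0, 1) + f (-1, 0) + f (0, -1) := by
        intro f
        unfold dirs
        rw [Finset.sum_insert (by decide), Finset.sum_insert (by decide),
          Finset.sum_insert (by decide), Finset.sum_singleton]
        ring
      rw [hd4] at hle
      calc (ext (k + 1) v h).card * 1000 ^ (k + 1)
          ≤ _ := Nat.mul_le_mul_right _ hle
        _ ≤ 1000 * (a + b + c + e) * 2718 ^ k := by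
          rw [pow_succ]; nlinarith [e1, e2, e3, e4]
        _ ≤ 2718 * st.2.1 * 2718 ^ k := Nat.mul_le_mul_right _ this.2
        _ = st.2.1 * 2718 ^ (k + 1) := by ring
    · simp at this

theorem ext_mem (w : List Site) : ∀ (v : Site) (h : List Site),
    List.IsChain (fun x y : Site => y - x ∈ dirs) (v :: w) → w.Nodup → (∀ x ∈ w, x ∉ h) →
    w ∈ ext w.length v h := by
  induction w with
  | nil => intro v h _ _ _; simp [ext]
  | cons u w ih =>
    intro v h hc hn hh
    rw [List.length_cons, ext, Finset.mem_biUnion]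
    rw [List.isChain_cons_cons] at hc
    refine ⟨u - v, hc.1, ?_⟩
    rw [add_sub_cancel, if_neg (hh u (by simp))]
    refine Finset.mem_image_of_mem _ (ih u _ hc.2 (List.nodup_cons.1 hn).2 ?_)
    intro x hx
    rw [List.mem_cons, not_or]
    refine ⟨?_, hh x (by simp [hx])⟩
    rintro rfl
    exact (List.nodup_cons.1 hn).1 hx

/-- Starting state bound: walks from `v` with one earlier vertex `v - d`. -/
theorem ext_bound (k : ℕ) (v u : Site) (hu : u - v ∈ dirs) :
    ((ext k v [v, u]).card : ℝ) ≤ 32000 * 2.718 ^ k := by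
  have hA : ∃ a, v + symA a (-1, 0) = u := by
    have : u = v + (u - v) := by abel
    simp only [dirs, Finset.mem_insert, Finset.mem_singleton] at hu
    rcases hu with h | h | h | h
    · exact ⟨2, by rw [this, h]; rfl⟩
    · exact ⟨5, by rw [this, h]; rfl⟩
    · exact ⟨0, by rw [this, h]; rfl⟩
    · exact ⟨1, by rw [this, h]; rfl⟩
  obtain ⟨a, ha⟩ := hA
  have := ext_card k v [v, u] (0x78, 32000, 0xd000009000) (symA a) (by simp [tab]) (symA_add a)
    (symA_dirs a) (by simp) (by
      intro o ho
      have : occ (0x78, 32000, 0xd000009000) = [(-1, 0)] := by decide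
      rw [this] at ho
      obtain rfl : o = (-1, 0) := by simpa using ho
      rw [ha]; simp)
  have h2 : ((ext k v [v, u]).card : ℝ) * 1000 ^ k ≤ 32000 * 2718 ^ k := by exact_mod_cast this
  have h3 : (2.718 : ℝ) ^ k = 2718 ^ k / 1000 ^ k := by rw [← div_pow]; norm_num
  rw [h3, ← mul_div_assoc, le_div_iff₀ (by positivity)]
  exact h2

/-! ### Part K: parity of contours -/

/-- Unit steps. -/
def stp (b : Bool) : Site := if b then (0, 1) else (1, 0)

/-- Lower end of the dual bond crossing the edge `(z, z + stp b)`. -/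
def dlo (z : Site) (b : Bool) : DualV := if b then (z.1 - 1, z.2) else (z.1, z.2 - 1)

/-- The dual bond `e` crosses the primal edge `(z, z + stp b)`. -/
def cr (z : Site) (b : Bool) (e : DualV × DualV) : Prop := e = (dlo z b, z) ∨ e = (z, dlo z b)

/-- Some bond of `l` crosses the edge. -/
def hasB (l : List DualV) (z : Site) (b : Bool) : Prop := ∃ i < l.length, cr z b (cEdge l i)

/-- Closed circuits of distinct bonds. -/
def PreC (l : List DualV) : Prop :=
  l ≠ [] ∧
  (∀ i < l.length, SiteAdj (cVert l i) (cVert l (i + 1))) ∧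
  (∀ i < l.length, ∀ j < l.length, i ≠ j →
      cEdge l i ≠ cEdge l j ∧ cEdge l i ≠ ((cEdge l j).2, (cEdge l j).1))

theorem IsContour.pre {l : List DualV} (h : IsContour l) : PreC l := ⟨h.1, h.2.1, h.2.2.1⟩

/-- Indicator mod 2. -/
def chi (P : Prop) : ZMod 2 := if P then 1 else 0

theorem chi_inj {P Q : Prop} : chi P = chi Q ↔ (P ↔ Q) := by
  unfold chi; by_cases hP : P <;> by_cases hQ : Q <;> simp [hP, hQ]

theorem chi_eq_one {P : Prop} : chi P = 1 ↔ P := by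
  unfold chi; by_cases hP : P <;> simp [hP]

theorem chi_eq_zero {P : Prop} : chi P = 0 ↔ ¬ P := by
  unfold chi; by_cases hP : P <;> simp [hP]

theorem chi_inContour (l : List DualV) (x : Site) :
    chi (inContour l x) = ∑ i ∈ Finset.range l.length, chi (crossesRay x (cEdge l i)) := by
  unfold inContour
  simp only [chi]
  rw [Finset.sum_boole]
  split_ifs with h
  · exact ((ZMod.natCast_eq_one_iff_odd).2 h).symm
  · rw [Nat.not_odd_iff_even] at h
    exact ((ZMod.natCast_eq_zero_iff_even).2 h).symm

theorem cVert_len (l : List DualV) : cVert l l.length = cVert l 0 := by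
  simp [cVert]

theorem sum_cyc (l : List DualV) (f : DualV → ZMod 2) :
    ∑ i ∈ Finset.range l.length, (f (cVert l i) + f (cVert l (i + 1))) = 0 := by
  rw [Finset.sum_add_distrib]
  have h : ∑ i ∈ Finset.range l.length, f (cVert l (i + 1)) =
      ∑ i ∈ Finset.range l.length, f (cVert l i) := by
    have h1 := Finset.sum_range_succ (fun i => f (cVert l i)) l.length
    have h2 := Finset.sum_range_succ' (fun i => f (cVert l i)) l.length
    rw [h1, cVert_len] at h2
    exact (add_right_cancel h2).symm
  rw [h]
  exact CharTwo.add_self_eq_zero _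

theorem adj_cases {x y : Site} (h : SiteAdj x y) :
    y = (x.1 + 1, x.2) ∨ y = (x.1 - 1, x.2) ∨ y = (x.1, x.2 + 1) ∨ y = (x.1, x.2 - 1) := by
  unfold SiteAdj at h
  rcases x with ⟨a, b⟩; rcases y with ⟨c, d⟩
  simp only [Prod.mk.injEq] at *
  omega

theorem chi_true {P : Prop} (h : P) : chi P = 1 := chi_eq_one.2 h
theorem chi_false {P : Prop} (h : ¬ P) : chi P = 0 := chi_eq_zero.2 h

theorem local_h (z : Site) (e : DualV × DualV) :
    chi (cr z false e) = chi (crossesRay z e) + chi (crossesRay (z + stp false) e) := by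
  rcases z with ⟨a, b⟩; rcases e with ⟨⟨c, d⟩, ⟨f, g⟩⟩
  have h : cr (a, b) false ((c, d), (f, g)) ↔
      ((crossesRay (a, b) ((c, d), (f, g))) ∧ ¬ crossesRay ((a, b) + stp false) ((c, d), (f, g))) := by
    simp only [cr, dlo, stp, crossesRay, Prod.mk.injEq]
    simp
    omega
  have h' : crossesRay ((a, b) + stp false) ((c, d), (f, g)) →
      crossesRay (a, b) ((c, d), (f, g)) := by
    simp only [stp, crossesRay, Prod.mk.injEq]
    simp
    omega
  rw [chi_inj.2 h]
  by_cases h1 : crossesRay (a, b) ((c, d), (f, g)) <;>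
    by_cases h2 : crossesRay ((a, b) + stp false) ((c, d), (f, g)) <;> simp [chi, h1, h2]
  · decide
  · exact h1 (h' h2)

theorem local_v (z : Site) (e : DualV × DualV) (he : SiteAdj e.1 e.2) :
    chi (cr z true e) = chi (crossesRay z e) + chi (crossesRay (z + stp true) e) +
      (chi (e.1.2 = z.2 ∧ z.1 ≤ e.1.1) + chi (e.2.2 = z.2 ∧ z.1 ≤ e.2.1)) := by
  rcases z with ⟨a, b⟩; rcases e with ⟨⟨c, d⟩, y⟩
  have h2 : (1 : ZMod 2) + 1 = 0 := by decide
  change SiteAdj (c, d) y at he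
  rcases adj_cases he with h | h | h | h <;> subst h <;>
  simp only [cr, dlo, stp, crossesRay, Prod.mk.injEq, Prod.mk_add_mk, chi, if_true, true_and, and_true] <;>
  split_ifs <;> first | (exfalso; omega) | (simp [h2]; done) | decide

theorem sum_cr (l : List DualV) (hadj : ∀ i < l.length, SiteAdj (cVert l i) (cVert l (i + 1)))
    (z : Site) (b : Bool) :
    ∑ i ∈ Finset.range l.length, chi (cr z b (cEdge l i)) =
      chi (inContour l z) + chi (inContour l (z + stp b)) := by
  rw [chi_inContour, chi_inContour, ← Finset.sum_add_distrib]
  cases b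
  · exact Finset.sum_congr rfl fun i _ => local_h z _
  · rw [Finset.sum_congr rfl fun i hi => local_v z (cEdge l i) (hadj i (Finset.mem_range.1 hi))]
    rw [Finset.sum_add_distrib]
    have := sum_cyc l (fun d => chi (d.2 = z.2 ∧ z.1 ≤ d.1))
    simp only [cEdge]
    rw [this, add_zero]

theorem cr_swap {z z' : Site} {b b' : Bool} {e : DualV × DualV} (h : cr z b e) (h' : cr z' b' e) :
    z = z' ∧ b = b' := by
  rcases z with ⟨x, y⟩; rcases z' with ⟨x', y'⟩; rcases e with ⟨⟨c, d⟩, ⟨f, g⟩⟩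
  cases b <;> cases b' <;> simp [cr, dlo] at h h' ⊢ <;> omega

theorem cr_unique {z : Site} {b : Bool} {e e' : DualV × DualV} (h : cr z b e) (h' : cr z b e') :
    e = e' ∨ e = (e'.2, e'.1) := by
  rcases h with rfl | rfl <;> rcases h' with rfl | rfl <;> simp

theorem cr_exists {e : DualV × DualV} (h : SiteAdj e.1 e.2) : ∃ z b, cr z b e := by
  rcases e with ⟨⟨c, d⟩, y⟩
  change SiteAdj (c, d) y at h
  rcases adj_cases h with h | h | h | h <;> subst h
  · exact ⟨(c + 1, d), true, by simp [cr, dlo]⟩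
  · exact ⟨(c, d), true, by simp [cr, dlo]⟩
  · exact ⟨(c, d + 1), false, by simp [cr, dlo]⟩
  · exact ⟨(c, d), false, by simp [cr, dlo]⟩

theorem PreC.key {l : List DualV} (hl : PreC l) (z : Site) (b : Bool) :
    hasB l z b ↔ ¬ (inContour l z ↔ inContour l (z + stp b)) := by
  have h1 := sum_cr l hl.2.1 z b
  have h2 : ∑ i ∈ Finset.range l.length, chi (cr z b (cEdge l i)) = chi (hasB l z b) := by
    by_cases h : hasB l z b
    · obtain ⟨i, hi, hc⟩ := h
      rw [Finset.sum_eq_single i]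
      · rw [chi_true hc, chi_true ⟨i, hi, hc⟩]
      · intro j hj hne
        refine chi_false fun hc' => ?_
        have h3 := hl.2.2 j (Finset.mem_range.1 hj) i hi hne
        rcases cr_unique hc' hc with h4 | h4
        · exact h3.1 h4
        · exact h3.2 h4
      · intro h; exact absurd (Finset.mem_range.2 hi) h
    · rw [chi_false h]
      refine Finset.sum_eq_zero fun i hi => chi_false fun hc => h ⟨i, Finset.mem_range.1 hi, hc⟩
  rw [h2] at h1
  have h2 : (1 : ZMod 2) + 1 = 0 := by decide
  by_cases a : inContour l z <;> by_cases b' : inContour l (z + stp b) <;>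
    simp [chi, a, b', h2] at h1 ⊢ <;> exact h1

theorem cVert_mem {l : List DualV} (hl : l ≠ []) (i : ℕ) : cVert l i ∈ l := by
  unfold cVert
  have : i % l.length < l.length := Nat.mod_lt _ (List.length_pos_iff.2 hl)
  rw [List.getD_eq_getElem _ _ this]
  exact List.getElem_mem _

theorem foldr_min_le (l : List ℤ) : ∀ x ∈ l, l.foldr min 0 ≤ x := by
  induction l with
  | nil => simp
  | cons a l ih =>
    intro x hx
    rw [List.foldr_cons]
    rcases List.mem_cons.1 hx with rfl | h
    · exact min_le_left _ _
    · exact (min_le_right _ _).trans (ih x h)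

theorem le_foldr_max (l : List ℤ) : ∀ x ∈ l, x ≤ l.foldr max 0 := by
  induction l with
  | nil => simp
  | cons a l ih =>
    intro x hx
    rw [List.foldr_cons]
    rcases List.mem_cons.1 hx with rfl | h
    · exact le_max_left _ _
    · exact (ih x h).trans (le_max_right _ _)

theorem PreC.bbox {l : List DualV} (hl : PreC l) {x : Site} (hx : inContour l x) :
    x ∈ cBBox l := by
  have m1 : ∀ i, (l.map Prod.fst).foldr min 0 ≤ (cVert l i).1 := fun i =>
    foldr_min_le _ _ (List.mem_map_of_mem (cVert_mem hl.1 i))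
  have m2 : ∀ i, (l.map Prod.snd).foldr min 0 ≤ (cVert l i).2 := fun i =>
    foldr_min_le _ _ (List.mem_map_of_mem (cVert_mem hl.1 i))
  have M1 : ∀ i, (cVert l i).1 ≤ (l.map Prod.fst).foldr max 0 := fun i =>
    le_foldr_max _ _ (List.mem_map_of_mem (cVert_mem hl.1 i))
  have M2 : ∀ i, (cVert l i).2 ≤ (l.map Prod.snd).foldr max 0 := fun i =>
    le_foldr_max _ _ (List.mem_map_of_mem (cVert_mem hl.1 i))
  have hex : ∃ i, crossesRay x (cEdge l i) := by
    by_contra hno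
    push Not at hno
    have := chi_inContour l x
    rw [chi_true hx, Finset.sum_eq_zero fun i _ => chi_false (hno i)] at this
    exact absurd this (by decide)
  have hleft : (l.map Prod.fst).foldr min 0 ≤ x.1 := by
    by_contra hlt
    have := chi_inContour l x
    rw [chi_true hx] at this
    have h0 := sum_cyc l (fun d => chi (x.2 ≤ d.2))
    rw [Finset.sum_congr rfl] at this
    · rw [h0] at this
      exact absurd this (by decide)
    · intro i hi
      have ha := hl.2.1 i (Finset.mem_range.1 hi)
      have q1 := m1 i
      have q2 := m1 (i + 1)
      have hA := adj_cases ha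
      unfold cEdge crossesRay
      generalize cVert l i = u at *
      generalize cVert l (i + 1) = w at *
      have h2 : (1 : ZMod 2) + 1 = 0 := by decide
      rcases u with ⟨a, b⟩
      rcases x with ⟨c, d⟩
      rcases hA with h | h | h | h <;> subst h <;> simp only [chi, Prod.mk.injEq, true_and, and_true] at * <;>
      split_ifs <;> first | (exfalso; omega) | (simp [h2]; done) | decide
  obtain ⟨i, hi⟩ := hex
  have q1 := m2 i
  have q2 := m2 (i + 1)
  have q3 := M2 i
  have q4 := M2 (i + 1)
  have q5 := M1 i
  have q6 := M1 (i + 1)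
  rw [cBBox, Finset.mem_Icc, Prod.le_def, Prod.le_def]
  simp only [crossesRay, cEdge] at hi
  rcases hi with ⟨h1, h2, h3⟩ | ⟨h1, h2, h3⟩
  · refine ⟨⟨?_, ?_⟩, ⟨?_, ?_⟩⟩ <;> simp only <;> omega
  · refine ⟨⟨?_, ?_⟩, ⟨?_, ?_⟩⟩ <;> simp only <;> omega

/-- Edge boundary of a finite set. -/
def bd (X : Finset Site) : Finset (Site × Bool) :=
  ((X ∪ X.image (fun z => z - stp false) ∪ X.image (fun z => z - stp true)) ×ˢ Finset.univ).filter
    (fun p => ¬ (p.1 ∈ X ↔ p.1 + stp p.2 ∈ X))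

theorem mem_bd {X : Finset Site} {p : Site × Bool} :
    p ∈ bd X ↔ ¬ (p.1 ∈ X ↔ p.1 + stp p.2 ∈ X) := by
  unfold bd
  rw [Finset.mem_filter]
  refine ⟨fun h => h.2, fun h => ⟨?_, h⟩⟩
  rw [Finset.mem_product]
  refine ⟨?_, Finset.mem_univ _⟩
  by_cases h1 : p.1 ∈ X
  · simp [h1]
  · have h2 : p.1 + stp p.2 ∈ X := by tauto
    rcases p with ⟨z, b⟩
    simp only [Finset.mem_union, Finset.mem_image]
    cases b
    · exact Or.inl (Or.inr ⟨_, h2, by simp⟩)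
    · exact Or.inr ⟨_, h2, by simp⟩

/-- The interior as a finset. -/
def intr (l : List DualV) : Finset Site := (cBBox l).filter (fun x => inContour l x)

theorem PreC.mem_intr {l : List DualV} (hl : PreC l) {x : Site} :
    x ∈ intr l ↔ inContour l x := by
  unfold intr
  rw [Finset.mem_filter]
  exact ⟨fun h => h.2, fun h => ⟨hl.bbox h, h⟩⟩

theorem PreC.mem_bd_intr {l : List DualV} (hl : PreC l) {z : Site} {b : Bool} :
    (z, b) ∈ bd (intr l) ↔ hasB l z b := by
  rw [mem_bd, hl.mem_intr, hl.mem_intr, hl.key]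

theorem PreC.len_le {l : List DualV} (hl : PreC l) : l.length ≤ (bd (intr l)).card := by
  have hex : ∀ i, ∃ p : Site × Bool, i < l.length → cr p.1 p.2 (cEdge l i) := by
    intro i
    by_cases hi : i < l.length
    · obtain ⟨z, b, h⟩ := cr_exists (e := cEdge l i) (hl.2.1 i hi)
      exact ⟨(z, b), fun _ => h⟩
    · exact ⟨((0, 0), false), fun h => absurd h hi⟩
  choose f hf using hex
  rw [← Finset.card_range l.length]
  apply Finset.card_le_card_of_injOn f
  · intro i hi
    have hi' : i < l.length := by simpa using hi
    exact hl.mem_bd_intr.2 ⟨i, hi', hf i hi'⟩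
  · intro i hi j hj hij
    by_contra hne
    have hi' : i < l.length := by simpa using hi
    have hj' : j < l.length := by simpa using hj
    have h1 := hf i hi'
    have h2 := hf j hj'
    rw [hij] at h1
    have h3 := hl.2.2 i hi' j hj' hne
    rcases cr_unique h1 h2 with h4 | h4
    · exact h3.1 h4
    · exact h3.2 h4

/-! ### Part 2: minimal boundaries -/

/-- Sets whose boundary contains no smaller boundary. -/
def Good (B : Finset Site) : Prop :=
  B.Nonempty ∧ ∀ X : Finset Site, bd X ⊆ bd B → X = ∅ ∨ X = B

theorem exit_pos (B : Finset Site) (z : Site) (hz : z ∈ B) (s : Site) (hs : s ≠ 0) :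
    ∃ k : ℕ, (∀ i ≤ k, z + (i : ℤ) • s ∈ B) ∧ z + ((k : ℤ) + 1) • s ∉ B := by
  have hex : ∃ k : ℕ, z + (k : ℤ) • s ∉ B := by
    by_contra hno
    push Not at hno
    have hinj : Function.Injective (fun k : ℕ => z + (k : ℤ) • s) := by
      intro a b hab
      have h1 : (a : ℤ) • s = (b : ℤ) • s := add_left_cancel hab
      have h2 : ((a : ℤ) - b) • s = 0 := by rw [sub_smul, h1, sub_self]
      rcases smul_eq_zero.1 h2 with h3 | h3
      · exact_mod_cast sub_eq_zero.1 h3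
      · exact absurd h3 hs
    exact Set.infinite_range_of_injective hinj
      (B.finite_toSet.subset (by rintro _ ⟨k, rfl⟩; exact hno k))
  have h0 : Nat.find hex ≠ 0 := by
    intro h
    have := Nat.find_spec hex
    rw [h] at this
    simp [hz] at this
  obtain ⟨k, hk⟩ := Nat.exists_eq_succ_of_ne_zero h0
  refine ⟨k, fun i hi => ?_, ?_⟩
  · have := Nat.find_min hex (m := i) (by omega)
    simpa using this
  · have := Nat.find_spec hex
    rw [hk] at this
    simpa using this

/-- The coordinate constant along the line in direction `b`. -/
def crd (b : Bool) (z : Site) : ℤ := if b then z.1 else z.2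

theorem crd_stp (b : Bool) (z : Site) (k : ℤ) : crd b (z + k • stp b) = crd b z := by
  cases b <;> simp [crd, stp]

theorem bd_card (B : Finset Site) :
    2 * (B.image Prod.fst).card + 2 * (B.image Prod.snd).card ≤ (bd B).card := by
  let F : Site × Bool → Bool × Bool × ℤ := fun p => (p.2, decide (p.1 ∈ B), crd p.2 p.1)
  have hsub : (({true} : Finset Bool) ×ˢ ((Finset.univ : Finset Bool) ×ˢ (B.image Prod.fst))) ∪
      (({false} : Finset Bool) ×ˢ ((Finset.univ : Finset Bool) ×ˢ (B.image Prod.snd))) ⊆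
      (bd B).image F := by
    have main : ∀ b : Bool, ∀ t : Bool, ∀ z ∈ B, (b, t, crd b z) ∈ (bd B).image F := by
      intro b t z hz
      rw [Finset.mem_image]
      have hs : stp b ≠ 0 := by cases b <;> simp [stp]
      cases t
      · obtain ⟨k, hk1, hk2⟩ := exit_pos B z hz (-stp b) (neg_ne_zero.2 hs)
        refine ⟨(z + ((k : ℤ) + 1) • (-stp b), b), ?_, ?_⟩
        · rw [mem_bd]
          have h1 : z + ((k : ℤ) + 1) • (-stp b) + stp b = z + (k : ℤ) • (-stp b) := by
            rw [add_smul, one_smul]; abel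
          simp only
          rw [h1]
          have := hk1 k le_rfl
          tauto
        · simp only [F, Prod.mk.injEq, true_and]
          refine ⟨by simpa using hk2, ?_⟩
          rw [smul_neg, ← neg_smul, crd_stp]
      · obtain ⟨k, hk1, hk2⟩ := exit_pos B z hz (stp b) hs
        refine ⟨(z + (k : ℤ) • (stp b), b), ?_, ?_⟩
        · rw [mem_bd]
          have h1 : z + ((k : ℤ)) • (stp b) + stp b = z + ((k : ℤ) + 1) • (stp b) := by
            rw [add_smul, one_smul]; abel
          simp only
          rw [h1]
          have := hk1 k le_rfl
          tauto
        · simp only [F, Prod.mk.injEq, true_and]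
          refine ⟨by simpa using hk1 k le_rfl, ?_⟩
          rw [crd_stp]
    intro p hp
    rcases p with ⟨b, t, c⟩
    simp only [Finset.mem_union, Finset.mem_product, Finset.mem_singleton, Finset.mem_univ,
      true_and, Finset.mem_image] at hp
    rcases hp with ⟨rfl, z, hz, rfl⟩ | ⟨rfl, z, hz, rfl⟩
    · exact main true t z hz
    · exact main false t z hz
  have h1 := (Finset.card_le_card hsub).trans Finset.card_image_le
  rw [Finset.card_union_of_disjoint] at h1
  · simpa [Finset.card_product] using h1
  · rw [Finset.disjoint_left]
    rintro ⟨b, t, c⟩ h h'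
    simp only [Finset.mem_product, Finset.mem_singleton] at h h'
    rw [h.1] at h'
    exact absurd h'.1 (by decide)

theorem bd_card_four {B : Finset Site} (h : B.Nonempty) : 4 ≤ (bd B).card := by
  have h1 := bd_card B
  have h2 := (h.image Prod.fst).card_pos
  have h3 := (h.image Prod.snd).card_pos
  omega

theorem bd_card_six {B : Finset Site} {x : Site} (hx : x ∈ B) (h : B ≠ {x}) :
    6 ≤ (bd B).card := by
  have h1 := bd_card B
  have hne : B.Nonempty := ⟨x, hx⟩
  have h2 := (hne.image Prod.fst).card_pos
  have h3 := (hne.image Prod.snd).card_pos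
  by_contra hlt
  have e1 : (B.image Prod.fst).card ≤ 1 := by omega
  have e2 : (B.image Prod.snd).card ≤ 1 := by omega
  apply h
  ext y
  rw [Finset.mem_singleton]
  refine ⟨fun hy => ?_, fun hy => hy ▸ hx⟩
  exact Prod.ext
    (Finset.card_le_one.1 e1 _ (Finset.mem_image_of_mem _ hy) _ (Finset.mem_image_of_mem _ hx))
    (Finset.card_le_one.1 e2 _ (Finset.mem_image_of_mem _ hy) _ (Finset.mem_image_of_mem _ hx))

theorem bd_empty : bd ∅ = ∅ := by
  ext p; simp [mem_bd]

/-- Adjacent dual vertices joined by a bond of the boundary of `B`. -/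
def bAdj (B : Finset Site) (u v : DualV) : Prop := ∃ z b, cr z b (u, v) ∧ (z, b) ∈ bd B

theorem bAdj.sub {B : Finset Site} {u v : DualV} (h : bAdj B u v) : v - u ∈ dirs := by
  obtain ⟨z, b, h, -⟩ := h
  rcases h with h | h <;> (obtain ⟨rfl, rfl⟩ := Prod.mk.inj h) <;> cases b <;>
    simp [dlo, dirs, Prod.ext_iff]

theorem bAdj.adj {B : Finset Site} {u v : DualV} (h : bAdj B u v) : SiteAdj u v := by
  obtain ⟨z, b, h, -⟩ := h
  rcases h with h | h <;> (obtain ⟨rfl, rfl⟩ := Prod.mk.inj h) <;> cases b <;>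
    simp [dlo, SiteAdj]

theorem bAdj_next {B : Finset Site} {u v : DualV} (h : bAdj B u v) : ∃ w, bAdj B v w ∧ w ≠ u := by
  have hW : ∀ z : Site, ((z ∈ B) ↔ ¬ ((z.1, z.2 + 1) ∈ B)) → bAdj B z (z.1 - 1, z.2) := by
    intro z hz
    refine ⟨z, true, Or.inr (by simp [dlo]), ?_⟩
    rw [mem_bd]
    have : z + stp true = (z.1, z.2 + 1) := by simp [stp, Prod.ext_iff]
    simp only
    rw [this]; tauto
  have hS : ∀ z : Site, ((z ∈ B) ↔ ¬ ((z.1 + 1, z.2) ∈ B)) → bAdj B z (z.1, z.2 - 1) := by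
    intro z hz
    refine ⟨z, false, Or.inr (by simp [dlo]), ?_⟩
    rw [mem_bd]
    have : z + stp false = (z.1 + 1, z.2) := by simp [stp, Prod.ext_iff]
    simp only
    rw [this]; tauto
  have hE : ∀ z : Site, (((z.1 + 1, z.2) ∈ B) ↔ ¬ ((z.1 + 1, z.2 + 1) ∈ B)) →
      bAdj B z (z.1 + 1, z.2) := by
    intro z hz
    refine ⟨(z.1 + 1, z.2), true, Or.inl (by simp [dlo]), ?_⟩
    rw [mem_bd]
    have : (z.1 + 1, z.2) + stp true = (z.1 + 1, z.2 + 1) := by simp [stp, Prod.ext_iff]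
    simp only
    rw [this]; tauto
  have hN : ∀ z : Site, (((z.1, z.2 + 1) ∈ B) ↔ ¬ ((z.1 + 1, z.2 + 1) ∈ B)) →
      bAdj B z (z.1, z.2 + 1) := by
    intro z hz
    refine ⟨(z.1, z.2 + 1), false, Or.inl (by simp [dlo]), ?_⟩
    rw [mem_bd]
    have : (z.1, z.2 + 1) + stp false = (z.1 + 1, z.2 + 1) := by simp [stp, Prod.ext_iff]
    simp only
    rw [this]; tauto
  by_contra hno
  push Not at hno
  have gW : u ≠ (v.1 - 1, v.2) → ((v ∈ B) ↔ ((v.1, v.2 + 1) ∈ B)) := by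
    intro hne; by_contra hc; exact hne (hno _ (hW v (by tauto))).symm
  have gS : u ≠ (v.1, v.2 - 1) → ((v ∈ B) ↔ ((v.1 + 1, v.2) ∈ B)) := by
    intro hne; by_contra hc; exact hne (hno _ (hS v (by tauto))).symm
  have gE : u ≠ (v.1 + 1, v.2) → (((v.1 + 1, v.2) ∈ B) ↔ ((v.1 + 1, v.2 + 1) ∈ B)) := by
    intro hne; by_contra hc; exact hne (hno _ (hE v (by tauto))).symm
  have gN : u ≠ (v.1, v.2 + 1) → (((v.1, v.2 + 1) ∈ B) ↔ ((v.1 + 1, v.2 + 1) ∈ B)) := by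
    intro hne; by_contra hc; exact hne (hno _ (hN v (by tauto))).symm
  obtain ⟨z, b, h1, h2⟩ := h
  rw [mem_bd] at h2
  simp only at h2
  rcases h1 with h1 | h1 <;> obtain ⟨rfl, rfl⟩ := Prod.mk.inj h1 <;> cases b <;>
    simp [dlo, stp, Prod.ext_iff] at gW gS gE gN h2
  · rw [show v + ((1 : ℤ), (0 : ℤ)) = (v.1 + 1, v.2) from by simp [Prod.ext_iff]] at h2
    have := gN (by omega)
    tauto
  · rw [show v + ((0 : ℤ), (1 : ℤ)) = (v.1, v.2 + 1) from by simp [Prod.ext_iff]] at h2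
    have := gE (by omega)
    tauto
  · rw [show u + ((1 : ℤ), (0 : ℤ)) = (u.1 + 1, u.2) from by simp [Prod.ext_iff]] at h2
    have := gS (by omega)
    have := gW (by omega)
    tauto
  · rw [show u + ((0 : ℤ), (1 : ℤ)) = (u.1, u.2 + 1) from by simp [Prod.ext_iff]] at h2
    have := gW (by omega)
    have := gS (by omega)
    tauto

/-- The infinite walk along the boundary. -/
theorem exists_walk {B : Finset Site} {v0 v1 : DualV} (h : bAdj B v0 v1) :
    ∃ v : ℕ → DualV, v 0 = v0 ∧ v 1 = v1 ∧ (∀ k, bAdj B (v k) (v (k + 1))) ∧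
      ∀ k, v (k + 2) ≠ v k := by
  have hn : ∀ p : {p : DualV × DualV // bAdj B p.1 p.2},
      ∃ q : {p : DualV × DualV // bAdj B p.1 p.2}, q.1.1 = p.1.2 ∧ q.1.2 ≠ p.1.1 := by
    rintro ⟨⟨u, w⟩, hp⟩
    obtain ⟨y, hy, hne⟩ := bAdj_next hp
    exact ⟨⟨(w, y), hy⟩, rfl, hne⟩
  choose nx hnx using hn
  let s : ℕ → {p : DualV × DualV // bAdj B p.1 p.2} := fun k => nx^[k] ⟨(v0, v1), h⟩
  have hs : ∀ k, s (k + 1) = nx (s k) := fun k => Function.iterate_succ_apply' _ _ _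
  have h1 : ∀ k, (s (k + 1)).1.1 = (s k).1.2 := fun k => by rw [hs]; exact (hnx _).1
  refine ⟨fun k => (s k).1.1, rfl, ?_, ?_, ?_⟩
  · exact h1 0
  · intro k
    have := (s k).2
    rw [← h1] at this
    exact this
  · intro k
    simp only
    rw [h1, hs]
    exact (hnx _).2

theorem cVert_map (v : ℕ → DualV) (i m k : ℕ) (hm : 0 < m) :
    cVert ((List.range m).map (fun a => v (i + a))) k = v (i + k % m) := by
  unfold cVert
  have : k % m < m := Nat.mod_lt _ hm
  simp [this]

theorem walk_distinct {B : Finset Site} (hB : Good B) (v : ℕ → DualV)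
    (hadj : ∀ k, bAdj B (v k) (v (k + 1))) (hnb : ∀ k, v (k + 2) ≠ v k) :
    ∀ i j, i < j → j < (bd B).card → v i ≠ v j := by
  by_contra hcon
  have hex : ∃ j, ∃ i < j, j < (bd B).card ∧ v i = v j := by
    push Not at hcon
    obtain ⟨i, j, h1, h2, h3⟩ := hcon
    exact ⟨j, i, h1, h2, h3⟩
  obtain ⟨i, hij, hjn, hv⟩ := Nat.find_spec hex
  have hmin : ∀ b < Nat.find hex, ∀ a < b, v a ≠ v b := by
    intro b hb a hab hvv
    exact Nat.find_min hex hb ⟨a, hab, by omega, hvv⟩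
  generalize Nat.find hex = j at *
  obtain ⟨m, rfl⟩ : ∃ m, j = i + m := ⟨j - i, by omega⟩
  have hne1 : ∀ k, v k ≠ v (k + 1) := by
    intro k hk
    have := (hadj k).adj
    rw [← hk] at this
    simp [SiteAdj] at this
  have hm3 : 3 ≤ m := by
    by_contra hlt
    obtain rfl | rfl : m = 1 ∨ m = 2 := by omega
    · exact hne1 _ hv
    · exact hnb _ hv.symm
  set l : List DualV := (List.range m).map (fun a => v (i + a)) with hl
  have hlen : l.length = m := by simp [hl]
  have hcv : ∀ k ≤ m, cVert l k = v (i + k) := by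
    intro k hk
    rw [hl, cVert_map v i m k (by omega)]
    rcases Nat.lt_or_ge k m with h | h
    · rw [Nat.mod_eq_of_lt h]
    · obtain rfl : k = m := by omega
      simp [hv]
  have hinj : ∀ a < m, ∀ b < m, v (i + a) = v (i + b) → a = b := by
    intro a ha b hb h
    by_contra hne
    rcases Nat.lt_or_gt_of_ne hne with h' | h'
    · exact hmin (i + b) (by omega) (i + a) (by omega) h
    · exact hmin (i + a) (by omega) (i + b) (by omega) h.symm
  have hinj' : ∀ a < m, ∀ b ≤ m, v (i + a) = v (i + b) → a = b ∨ (a = 0 ∧ b = m) := by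
    intro a ha b hb h
    rcases Nat.lt_or_ge b m with h' | h'
    · exact Or.inl (hinj a ha b h' h)
    · obtain rfl : b = m := by omega
      rw [← hv] at h
      exact Or.inr ⟨hinj a ha 0 (by omega) h, rfl⟩
  have hpre : PreC l := by
    refine ⟨?_, ?_, ?_⟩
    · intro h; rw [h] at hlen; simp at hlen; omega
    · intro k hk
      rw [hlen] at hk
      rw [hcv k (by omega), hcv (k + 1) (by omega)]
      exact (hadj _).adj
    · intro a ha b hb hab
      rw [hlen] at ha hb
      simp only [cEdge]
      rw [hcv a (by omega), hcv (a + 1) (by omega), hcv b (by omega), hcv (b + 1) (by omega)]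
      refine ⟨fun h => hab (hinj a ha b hb (Prod.mk.inj h).1), fun h => ?_⟩
      obtain ⟨h1, h2⟩ := Prod.mk.inj h
      rcases hinj' a ha (b + 1) (by omega) h1 with h3 | h3 <;>
      rcases hinj' b hb (a + 1) (by omega) h2.symm with h4 | h4 <;> omega
  have hsub : bd (intr l) ⊆ bd B := by
    rintro ⟨z, b⟩ hp
    rw [hpre.mem_bd_intr] at hp
    obtain ⟨k, hk, hc⟩ := hp
    rw [hlen] at hk
    simp only [cEdge] at hc
    rw [hcv k (by omega), hcv (k + 1) (by omega)] at hc
    obtain ⟨z', b', h1, h2⟩ := hadj (i + k)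
    obtain ⟨rfl, rfl⟩ := cr_swap hc h1
    exact h2
  have hlenle := hpre.len_le
  have hle : (bd (intr l)).card ≤ m := by
    have hex : ∀ k, ∃ p : Site × Bool, cr p.1 p.2 (v (i + k), v (i + k + 1)) := by
      intro k
      obtain ⟨z', b', h1, h2⟩ := hadj (i + k)
      exact ⟨(z', b'), h1⟩
    choose f hf using hex
    have : bd (intr l) ⊆ (Finset.range m).image f := by
      rintro ⟨z, b⟩ hp
      rw [hpre.mem_bd_intr] at hp
      obtain ⟨k, hk, hc⟩ := hp
      rw [hlen] at hk
      simp only [cEdge] at hc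
      rw [hcv k (by omega), hcv (k + 1) (by omega)] at hc
      rw [Finset.mem_image]
      refine ⟨k, Finset.mem_range.2 hk, ?_⟩
      obtain ⟨h1, h2⟩ := cr_swap (hf k) hc
      exact Prod.ext h1 h2
    refine (Finset.card_le_card this).trans (Finset.card_image_le.trans ?_)
    simp
  rcases hB.2 _ hsub with h | h
  · rw [h, bd_empty, hlen, Finset.card_empty] at hlenle
    omega
  · rw [h] at hle
    omega

theorem chain_range (m : ℕ) : ∀ (f : ℕ → Site), (∀ i < m, f (i + 1) - f i ∈ dirs) →
    List.IsChain (fun x y : Site => y - x ∈ dirs)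
      (f 0 :: (List.range m).map (fun i => f (i + 1))) := by
  induction m with
  | zero => intro f _; simp
  | succ m ih =>
    intro f hf
    rw [List.range_succ_eq_map, List.map_cons, List.isChain_cons_cons, List.map_map]
    exact ⟨hf 0 (by omega), ih (fun i => f (i + 1)) (fun i hi => hf (i + 1) (by omega))⟩

/-- Coding of good sets. -/
theorem good_code (x : Site) {B : Finset Site} (hB : Good B) (hx : x ∈ B) :
    ∃ (j : ℕ) (v : ℕ → DualV), j < (bd B).card ∧ v 0 = (x.1 + j, x.2 - 1) ∧ v 1 = (x.1 + j, x.2) ∧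
      (List.range ((bd B).card - 2)).map (fun i => v (i + 2)) ∈
        ext ((bd B).card - 2) (x.1 + j, x.2) [(x.1 + j, x.2), (x.1 + j, x.2 - 1)] ∧
      v (bd B).card - v ((bd B).card - 1) ∈ dirs ∧
      ∀ z b, (z, b) ∈ bd B ↔ ∃ i < (bd B).card, cr z b (v i, v (i + 1)) := by
  obtain ⟨j, hj1, hj2⟩ := exit_pos B x hx (stp false) (by simp [stp])
  have hs : ∀ k : ℤ, x + k • stp false = (x.1 + k, x.2) := by
    intro k; simp [stp, Prod.ext_iff]
  have hstart : bAdj B (x.1 + j, x.2 - 1) (x.1 + j, x.2) := by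
    refine ⟨(x.1 + j, x.2), false, Or.inl (by simp [dlo]), ?_⟩
    rw [mem_bd]
    have h1 := hj1 j le_rfl
    rw [hs] at h1 hj2
    have h2 : ((x.1 + j, x.2) : Site) + stp false = (x.1 + (j + 1), x.2) := by
      simp [stp, Prod.ext_iff]; ring
    simp only
    rw [h2]
    tauto
  obtain ⟨v, hv0, hv1, hadj, hnb⟩ := exists_walk hstart
  have hdist := walk_distinct hB v hadj hnb
  have h4 := bd_card_four hB.1
  have hjn : j < (bd B).card := by
    have h1 := bd_card B
    have h2 : (Finset.range (j + 1)).card ≤ (B.image Prod.fst).card := by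
      apply Finset.card_le_card_of_injOn (fun i : ℕ => x.1 + i)
      · intro i hi
        have hi' : i ≤ j := by
          have := Finset.mem_range.1 hi; omega
        have := hj1 i hi'
        rw [hs] at this
        exact Finset.mem_image_of_mem Prod.fst this
      · intro a _ b _ hab
        simpa using hab
    rw [Finset.card_range] at h2
    omega
  have hN : ∃ n, (bd B).card = n + 2 := ⟨(bd B).card - 2, by omega⟩
  obtain ⟨n, hn⟩ := hN
  refine ⟨j, v, hjn, hv0, hv1, ?_, ?_, ?_⟩
  · rw [hn] at hdist ⊢
    simp only [Nat.add_sub_cancel]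
    have hlen : ((List.range n).map (fun i => v (i + 2))).length = n := by simp
    have := ext_mem ((List.range n).map (fun i => v (i + 2))) (x.1 + j, x.2)
      [(x.1 + j, x.2), (x.1 + j, x.2 - 1)] ?_ ?_ ?_
    · rwa [hlen] at this
    · have h := chain_range n (fun i => v (i + 1)) (fun i _ => (hadj (i + 1)).sub)
      rw [← hv1]
      exact h
    · refine List.Nodup.map_on ?_ List.nodup_range
      intro a ha b hb hab
      rw [List.mem_range] at ha hb
      by_contra hne
      rcases Nat.lt_or_gt_of_ne hne with h' | h'
      · exact hdist (a + 2) (b + 2) (by omega) (by omega) hab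
      · exact hdist (b + 2) (a + 2) (by omega) (by omega) hab.symm
    · intro y hy
      rw [List.mem_map] at hy
      obtain ⟨a, ha, rfl⟩ := hy
      rw [List.mem_range] at ha
      simp only [List.mem_cons, List.not_mem_nil, or_false, not_or]
      rw [← hv0, ← hv1]
      exact ⟨fun h => hdist 1 (a + 2) (by omega) (by omega) h.symm,
        fun h => hdist 0 (a + 2) (by omega) (by omega) h.symm⟩
  · have := (hadj ((bd B).card - 1)).sub
    rwa [Nat.sub_add_cancel (by omega)] at this
  · choose fz fb hf hfm using hadj
    have himg : (Finset.range (bd B).card).image (fun i => (fz i, fb i)) = bd B := by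
      apply Finset.eq_of_subset_of_card_le
      · intro p hp
        rw [Finset.mem_image] at hp
        obtain ⟨i, _, rfl⟩ := hp
        exact hfm i
      · rw [Finset.card_image_of_injOn, Finset.card_range]
        intro a ha b hb hab
        have ha' : a < (bd B).card := by simpa using ha
        have hb' : b < (bd B).card := by simpa using hb
        have h1 := hf a
        have h2 := hf b
        obtain ⟨e1, e2⟩ := Prod.mk.inj hab
        rw [e1, e2] at h1
        by_contra hne
        rcases cr_unique h1 h2 with h3 | h3
        · have h5 := (Prod.mk.inj h3).1
          rcases Nat.lt_or_gt_of_ne hne with h' | h'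
          · exact hdist a b h' hb' h5
          · exact hdist b a h' ha' h5.symm
        · obtain ⟨h5, h6⟩ := Prod.mk.inj h3
          simp only at h5 h6
          rcases Nat.lt_or_gt_of_ne hne with h' | h'
          · rcases Nat.lt_or_ge (a + 1) b with h'' | h''
            · exact hdist (a + 1) b h'' hb' h6
            · obtain rfl : b = a + 1 := by omega
              exact hnb a h5.symm
          · rcases Nat.lt_or_ge (b + 1) a with h'' | h''
            · exact hdist (b + 1) a h'' ha' h5.symm
            · obtain rfl : a = b + 1 := by omega
              exact hnb b h6
    intro z b
    constructor
    · intro h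
      rw [← himg, Finset.mem_image] at h
      obtain ⟨i, hi, h⟩ := h
      obtain ⟨rfl, rfl⟩ := Prod.mk.inj h
      exact ⟨i, Finset.mem_range.1 hi, hf i⟩
    · rintro ⟨i, _, hc⟩
      obtain ⟨rfl, rfl⟩ := cr_swap hc (hf i)
      exact hfm i

theorem good_count (x : Site) (n : ℕ) (𝓑 : Finset (Finset Site))
    (h : ∀ B ∈ 𝓑, Good B ∧ x ∈ B ∧ (bd B).card = n) :
    (𝓑.card : ℝ) ≤ 128000 * n * 2.718 ^ n := by
  have hcode : ∀ B : Finset Site, ∃ (j : ℕ) (v : ℕ → DualV), B ∈ 𝓑 →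
      (j < n ∧ v 0 = (x.1 + j, x.2 - 1) ∧ v 1 = (x.1 + j, x.2) ∧
      (List.range (n - 2)).map (fun i => v (i + 2)) ∈
        ext (n - 2) (x.1 + j, x.2) [(x.1 + j, x.2), (x.1 + j, x.2 - 1)] ∧
      v n - v (n - 1) ∈ dirs ∧
      ∀ z b, (z, b) ∈ bd B ↔ ∃ i < n, cr z b (v i, v (i + 1))) := by
    intro B
    by_cases hB : B ∈ 𝓑
    · obtain ⟨h1, h2, h3⟩ := h B hB
      obtain ⟨j, v, hh⟩ := good_code x h1 h2
      rw [h3] at hh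
      exact ⟨j, v, fun _ => hh⟩
    · exact ⟨0, fun _ => 0, fun h => absurd h hB⟩
  choose j v hjv using hcode
  let T : Finset (Σ _ : ℕ, List Site × Site) := (Finset.range n).sigma (fun j =>
    ext (n - 2) (x.1 + j, x.2) [(x.1 + j, x.2), (x.1 + j, x.2 - 1)] ×ˢ dirs)
  have hcard : 𝓑.card ≤ T.card := by
    apply Finset.card_le_card_of_injOn (fun B => (⟨j B, ((List.range (n - 2)).map
      (fun i => v B (i + 2)), v B n - v B (n - 1))⟩ : Σ _ : ℕ, List Site × Site))
    · intro B hB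
      obtain ⟨h1, h2, h3, h4, h5, h6⟩ := hjv B hB
      have : j B ∈ Finset.range n := Finset.mem_range.2 h1
      simp only [T, Finset.coe_sigma, Set.mem_sigma_iff, Finset.mem_coe, Finset.mem_product]
      exact ⟨this, h4, h5⟩
    · intro B hB B' hB' heq
      simp only [Sigma.mk.injEq, heq_eq_eq, Prod.mk.injEq] at heq
      obtain ⟨e1, e2, e3⟩ := heq
      obtain ⟨h1, h2, h3, h4, h5, h6⟩ := hjv B hB
      obtain ⟨h1', h2', h3', h4', h5', h6'⟩ := hjv B' hB'
      have g := h B hB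
      have g' := h B' hB'
      have hn4 := bd_card_four g.1.1
      rw [g.2.2] at hn4
      have hv1 : ∀ i < n, v B i = v B' i := by
        intro i hi
        rcases i with _ | _ | i
        · rw [h2, h2', e1]
        · rw [h3, h3', e1]
        · exact (List.map_inj_left.1 e2) i (List.mem_range.2 (by omega))
      have hv2 : ∀ i ≤ n, v B i = v B' i := by
        intro i hi
        rcases Nat.lt_or_ge i n with h | h
        · exact hv1 i h
        · obtain rfl : i = n := by omega
          rw [hv1 (i - 1) (by omega)] at e3
          exact sub_left_injective e3
      have hbd : bd B ⊆ bd B' := by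
        rintro ⟨z, b⟩ hp
        rw [h6] at hp
        obtain ⟨i, hi, hc⟩ := hp
        rw [h6']
        rw [hv2 i (by omega), hv2 (i + 1) (by omega)] at hc
        exact ⟨i, hi, hc⟩
      rcases g'.1.2 B hbd with h | h
      · rw [h] at g; simp at g
      · exact h
  have hT : (T.card : ℝ) ≤ n * (32000 * 2.718 ^ n * 4) := by
    simp only [T]
    rw [Finset.card_sigma]
    push_cast
    calc _ ≤ ∑ a ∈ Finset.range n, (32000 * 2.718 ^ n * 4 : ℝ) := by
            refine Finset.sum_le_sum fun a _ => ?_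
            rw [Finset.card_product]
            have hd : dirs.card = 4 := by decide
            rw [hd]
            push_cast
            refine mul_le_mul_of_nonneg_right ?_ (by norm_num)
            refine (ext_bound (n - 2) _ _ (by simp [dirs])).trans ?_
            refine mul_le_mul_of_nonneg_left ?_ (by norm_num)
            exact pow_le_pow_right₀ (by norm_num) (by omega)
      _ = _ := by simp
  calc (𝓑.card : ℝ) ≤ T.card := by exact_mod_cast hcard
    _ ≤ _ := hT
    _ = _ := by ring

theorem good_sum : ∃ K : ℝ, 0 ≤ K ∧ ∀ (x : Site) (𝓑 : Finset (Finset Site)),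
    (∀ B ∈ 𝓑, Good B ∧ x ∈ B) → ∑ B ∈ 𝓑, Real.exp (-((bd B).card : ℝ)) ≤ K := by
  have hgc : ∃ C r : ℝ, 0 ≤ C ∧ 0 ≤ r ∧ r < Real.exp 1 ∧
      ∀ (x : Site) (n : ℕ) (𝓑 : Finset (Finset Site)),
        (∀ B ∈ 𝓑, Good B ∧ x ∈ B ∧ (bd B).card = n) → (𝓑.card : ℝ) ≤ C * n * r ^ n :=
    ⟨128000, 2.718, by norm_num, by norm_num, lt_trans (by norm_num) Real.exp_one_gt_d9,
      good_count⟩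
  obtain ⟨C, r, hC, hr, he, hcount⟩ := hgc
  have hr1 : r / Real.exp 1 < 1 := by rw [div_lt_one (Real.exp_pos _)]; exact he
  have hr0 : 0 ≤ r / Real.exp 1 := by positivity
  have hsum0 : Summable (fun n : ℕ => ((n : ℝ) ^ 1 * (r / Real.exp 1) ^ n)) :=
    summable_pow_mul_geometric_of_norm_lt_one 1 (by
      rw [Real.norm_eq_abs, abs_of_nonneg hr0]; exact hr1)
  have hsum := hsum0.mul_left C
  refine ⟨∑' n : ℕ, C * ((n : ℝ) ^ 1 * (r / Real.exp 1) ^ n),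
    tsum_nonneg fun n => by positivity, ?_⟩
  intro x 𝓑 h
  have := Finset.sum_comp (s := 𝓑) (fun n : ℕ => Real.exp (-(n : ℝ))) (fun B => (bd B).card)
  rw [this]
  refine le_trans (Finset.sum_le_sum fun n _ => ?_) (hsum.sum_le_tsum _ fun n _ => by positivity)
  have hc := hcount x n (𝓑.filter (fun B => (bd B).card = n)) (by
    intro B hB
    rw [Finset.mem_filter] at hB
    exact ⟨(h B hB.1).1, (h B hB.1).2, hB.2⟩)
  rw [nsmul_eq_mul]
  calc _ ≤ C * (n : ℝ) * r ^ n * Real.exp (-(n : ℝ)) :=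
        mul_le_mul_of_nonneg_right hc (Real.exp_pos _).le
    _ = _ := by
      rw [div_pow, ← Real.exp_nat_mul, Real.exp_neg, mul_one]
      ring

/-! ### Part 3: the energy and the tail estimate -/

/-- Edges near the box. -/
def Ed (L : ℕ) : Finset (Site × Bool) :=
  (Finset.Icc ((0 : ℤ), (0 : ℤ)) ((L : ℤ), (L : ℤ))) ×ˢ Finset.univ

/-- Energy. -/
def Hm (L : ℕ) (η : Config) : ℤ := ∑ p ∈ Ed L, |η p.1 - η (p.1 + stp p.2)|

/-- Weight. -/
def wt (β : ℝ) (L : ℕ) (η : Config) : ℝ := Real.exp (-β * (Hm L η : ℝ))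

/-- Partition sums. -/
def Zs (β : ℝ) (L : ℕ) (s : Finset Config) : ℝ := ∑ η ∈ s, wt β L η

/-- Configurations supported in `V` with bounds. -/
def cfg (V : Finset Site) (lo hi : Site → ℤ) : Finset Config :=
  (V.pi (fun x => Finset.Icc (lo x) (hi x))).image
    (fun f x => if h : x ∈ V then f x h else 0)

theorem mem_cfg {V : Finset Site} {lo hi : Site → ℤ} {η : Config} :
    η ∈ cfg V lo hi ↔ (∀ x ∈ V, lo x ≤ η x ∧ η x ≤ hi x) ∧ ∀ x ∉ V, η x = 0 := by
  unfold cfg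
  rw [Finset.mem_image]
  constructor
  · rintro ⟨f, hf, rfl⟩
    rw [Finset.mem_pi] at hf
    refine ⟨fun x hx => ?_, fun x hx => by simp [hx]⟩
    have := hf x hx
    rw [Finset.mem_Icc] at this
    simpa [hx] using this
  · rintro ⟨h1, h2⟩
    refine ⟨fun x _ => η x, ?_, ?_⟩
    · rw [Finset.mem_pi]
      intro x hx
      rw [Finset.mem_Icc]
      exact h1 x hx
    · funext x
      by_cases hx : x ∈ V
      · simp [hx]
      · simp [hx, h2 x hx]

theorem wt_pos (β : ℝ) (L : ℕ) (η : Config) : 0 < wt β L η := Real.exp_pos _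

theorem Hm_nonneg (L : ℕ) (η : Config) : 0 ≤ Hm L η :=
  Finset.sum_nonneg fun _ _ => abs_nonneg _

theorem wt_le_one {β : ℝ} (hβ : 1 ≤ β) (L : ℕ) (η : Config) : wt β L η ≤ 1 := by
  unfold wt
  rw [Real.exp_le_one_iff]
  have : (0 : ℝ) ≤ (Hm L η : ℝ) := by exact_mod_cast Hm_nonneg L η
  nlinarith

theorem Zs_nonneg (β : ℝ) (L : ℕ) (s : Finset Config) : 0 ≤ Zs β L s :=
  Finset.sum_nonneg fun _ _ => (wt_pos _ _ _).le

theorem Zs_mono (β : ℝ) (L : ℕ) {s t : Finset Config} (h : s ⊆ t) : Zs β L s ≤ Zs β L t :=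
  Finset.sum_le_sum_of_subset_of_nonneg h fun _ _ _ => (wt_pos _ _ _).le

theorem bd_sub_Ed {L : ℕ} {X : Finset Site} (h : X ⊆ box L) : bd X ⊆ Ed L := by
  rintro ⟨⟨a, b⟩, c⟩ hp
  rw [mem_bd] at hp
  rw [Ed, Finset.mem_product]
  refine ⟨?_, Finset.mem_univ _⟩
  rw [Finset.mem_Icc, Prod.mk_le_mk, Prod.mk_le_mk]
  by_cases h1 : (a, b) ∈ X
  · have := h h1
    rw [box, Finset.mem_Icc, Prod.mk_le_mk, Prod.mk_le_mk] at this
    omega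
  · have h2 : (a, b) + stp c ∈ X := by simp only at hp; tauto
    have := h h2
    cases c <;> simp only [stp, Prod.mk_add_mk, if_true, Bool.false_eq_true, if_false] at this <;>
      rw [box, Finset.mem_Icc, Prod.mk_le_mk, Prod.mk_le_mk] at this <;> omega

theorem bd_inj {X Y : Finset Site} (h : bd X = bd Y) : X = Y := by
  by_contra hne
  have hS : (symmDiff X Y).Nonempty := by
    rw [Finset.nonempty_iff_ne_empty]
    intro h0
    exact hne (symmDiff_eq_bot.1 h0)
  have h4 := bd_card_four hS
  have h0 : bd (symmDiff X Y) = ∅ := by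
    rw [Finset.eq_empty_iff_forall_notMem]
    intro p hp
    have h1 : p ∈ bd X ↔ p ∈ bd Y := by rw [h]
    rw [mem_bd] at hp h1
    rw [mem_bd] at h1
    simp only [Finset.mem_symmDiff] at hp
    tauto
  rw [h0] at h4
  simp at h4

/-- Simply connected type condition. -/
def SC (V : Finset Site) : Prop :=
  ∀ X : Finset Site, (∀ z b, z ∉ V → z + stp b ∉ V → (z ∈ X ↔ z + stp b ∈ X)) → X ⊆ V

theorem exists_good {V : Finset Site} (hV : SC V) {x : Site} {P : Site → Prop}
    (hP : ∀ z, P z → z ∈ V) (hx : P x) :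
    ∃ B : Finset Site, B ⊆ V ∧ x ∈ B ∧ Good B ∧
      ∀ p ∈ bd B, (p.1 ∈ B ↔ P p.1) ∧ (p.1 + stp p.2 ∈ B ↔ P (p.1 + stp p.2)) := by
  let cand : Finset Site → Prop := fun B => x ∈ B ∧
      ∀ p ∈ bd B, (p.1 ∈ B ↔ P p.1) ∧ (p.1 + stp p.2 ∈ B ↔ P (p.1 + stp p.2))
  have hne : (V.powerset.filter cand).Nonempty := by
    refine ⟨V.filter P, ?_⟩
    have hm : ∀ z, z ∈ V.filter P ↔ P z := fun z => by
      rw [Finset.mem_filter]; exact ⟨fun h => h.2, fun h => ⟨hP z h, h⟩⟩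
    rw [Finset.mem_filter, Finset.mem_powerset]
    exact ⟨Finset.filter_subset _ _, (hm x).2 hx, fun p _ => ⟨hm _, hm _⟩⟩
  obtain ⟨B, hB, hmin⟩ := Finset.exists_min_image _ (fun B => (bd B).card) hne
  rw [Finset.mem_filter, Finset.mem_powerset] at hB
  obtain ⟨hBV, hxB, hBP⟩ := hB
  have claim : ∀ Y : Finset Site, bd Y ⊆ bd B → Y ⊆ V → x ∈ Y → (Y ⊆ B ∨ B ⊆ Y) → Y = B := by
    intro Y hY hYV hxY hor
    have hc : Y ∈ V.powerset.filter cand := by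
      rw [Finset.mem_filter, Finset.mem_powerset]
      refine ⟨hYV, hxY, fun p hp => ?_⟩
      have h1 := hY hp
      have h2 := hBP p h1
      rw [mem_bd] at hp h1
      rcases hor with h | h
      · have := @h p.1; have := @h (p.1 + stp p.2); tauto
      · have := @h p.1; have := @h (p.1 + stp p.2); tauto
    exact bd_inj (Finset.eq_of_subset_of_card_le hY (hmin Y hc))
  refine ⟨B, hBV, hxB, ⟨⟨x, hxB⟩, fun X hX => ?_⟩, hBP⟩
  have hXV : X ⊆ V := by
    refine hV X fun z b h1 h2 => ?_
    by_contra hne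
    have h3 : (z, b) ∈ bd B := hX (mem_bd.2 hne)
    rw [mem_bd] at h3
    have := @hBV z; have := @hBV (z + stp b)
    simp only at h3
    tauto
  have hsub : ∀ Y : Finset Site, (∀ z z' : Site, (z ∈ B ↔ z' ∈ B) → (z ∈ X ↔ z' ∈ X) →
      (z ∈ Y ↔ z' ∈ Y)) → bd Y ⊆ bd B := by
    intro Y hY p hp
    by_contra hn
    have hn' : p ∉ bd X := fun h => hn (hX h)
    rw [mem_bd] at hp hn hn'
    exact hp (hY _ _ (not_not.1 hn) (not_not.1 hn'))
  by_cases hxX : x ∈ X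
  · right
    have h1 : B ∩ X = B := claim (B ∩ X) (hsub _ (by
      intro z z' h1 h2; simp only [Finset.mem_inter]; tauto))
      (Finset.inter_subset_left.trans hBV) (Finset.mem_inter.2 ⟨hxB, hxX⟩)
      (Or.inl Finset.inter_subset_left)
    exact claim X hX hXV hxX (Or.inr (Finset.inter_eq_left.1 h1))
  · left
    have h1 : B \ X = B := claim (B \ X) (hsub _ (by
      intro z z' h1 h2; simp only [Finset.mem_sdiff]; tauto))
      (Finset.sdiff_subset.trans hBV) (Finset.mem_sdiff.2 ⟨hxB, hxX⟩)
      (Or.inl Finset.sdiff_subset)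
    have h2 : B ∪ X = B := claim (B ∪ X) (hsub _ (by
      intro z z' h1 h2; simp only [Finset.mem_union]; tauto))
      (Finset.union_subset hBV hXV) (Finset.mem_union.2 (Or.inl hxB))
      (Or.inr Finset.subset_union_left)
    rw [Finset.eq_empty_iff_forall_notMem]
    intro y hy
    have h3 : y ∈ B := by rw [← h2]; exact Finset.mem_union_right _ hy
    rw [← h1] at h3
    exact (Finset.mem_sdiff.1 h3).2 hy

/-- Indicator of a finite set. -/
def ind (B : Finset Site) : Config := fun z => if z ∈ B then 1 else 0

theorem sum_ind_bd {L : ℕ} {B : Finset Site} (hB : bd B ⊆ Ed L) :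
    ∑ p ∈ Ed L, (if p ∈ bd B then (1 : ℤ) else 0) = (bd B).card := by
  rw [Finset.sum_ite_mem, Finset.inter_eq_right.2 hB]
  simp

theorem edge_drop (h : ℕ) (B : ℕ → Finset Site) (η : Config) (p : Site × Bool)
    (hB : ∀ i < h, p ∈ bd (B i) → (p.1 ∈ B i ↔ η p.1 ≤ -((i : ℤ) + 1)) ∧
      (p.1 + stp p.2 ∈ B i ↔ η (p.1 + stp p.2) ≤ -((i : ℤ) + 1))) :
    |(η p.1 + ∑ i ∈ Finset.range h, ind (B i) p.1) -
      (η (p.1 + stp p.2) + ∑ i ∈ Finset.range h, ind (B i) (p.1 + stp p.2))| =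
      |η p.1 - η (p.1 + stp p.2)| - ∑ i ∈ Finset.range h, (if p ∈ bd (B i) then (1 : ℤ) else 0) := by
  have main : ∀ a c : ℤ, c ≤ a → ∀ f g k : ℕ → ℤ,
      (∀ i < h, (k i = 0 ∧ f i = g i) ∨ (k i = 1 ∧ f i - g i = -1 ∧ c ≤ -((i : ℤ) + 1) ∧
        -((i : ℤ) + 1) < a)) →
      |(a + ∑ i ∈ Finset.range h, f i) - (c + ∑ i ∈ Finset.range h, g i)| =
        |a - c| - ∑ i ∈ Finset.range h, k i := by
    intro a c hca f g k hk
    have h1 : ∑ i ∈ Finset.range h, f i - ∑ i ∈ Finset.range h, g i =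
        -∑ i ∈ Finset.range h, k i := by
      rw [← Finset.sum_sub_distrib, ← Finset.sum_neg_distrib]
      refine Finset.sum_congr rfl fun i hi => ?_
      rcases hk i (Finset.mem_range.1 hi) with h | h <;> omega
    have h2 : ∑ i ∈ Finset.range h, k i ≤ a - c := by
      have h3 : ∑ i ∈ Finset.range h, k i ≤
          ∑ i ∈ Finset.range h, (if c ≤ -((i : ℤ) + 1) ∧ -((i : ℤ) + 1) < a then (1 : ℤ) else 0) := by
        refine Finset.sum_le_sum fun i hi => ?_
        rcases hk i (Finset.mem_range.1 hi) with h | h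
        · rw [h.1]; split_ifs <;> norm_num
        · rw [if_pos ⟨h.2.2.1, h.2.2.2⟩, h.1]
      refine h3.trans ?_
      rw [Finset.sum_boole]
      have h4 : ((Finset.range h).filter
          (fun i : ℕ => c ≤ -((i : ℤ) + 1) ∧ -((i : ℤ) + 1) < a)).card ≤ (Finset.Ico c a).card := by
        apply Finset.card_le_card_of_injOn (fun i : ℕ => -((i : ℤ) + 1))
        · intro i hi
          have := (Finset.mem_filter.1 hi).2
          exact Finset.mem_coe.2 (Finset.mem_Ico.2 this)
        · intro i _ j _ hij
          simp only at hij
          omega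
      rw [Int.card_Ico] at h4
      have : ((a - c).toNat : ℤ) = a - c := Int.toNat_of_nonneg (by omega)
      rw [← this]
      exact_mod_cast h4
    rw [abs_of_nonneg (by omega : 0 ≤ a - c), abs_of_nonneg (by omega)]
    omega
  rcases le_total (η (p.1 + stp p.2)) (η p.1) with hle | hle
  · refine main _ _ hle _ _ _ fun i hi => ?_
    by_cases hp : p ∈ bd (B i)
    · right
      have h1 := hB i hi hp
      rw [mem_bd] at hp
      have h2 : p.1 ∉ B i := by
        intro hin
        have := h1.1.1 hin
        have := h1.2.2 (by omega)
        tauto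
      have h3 : p.1 + stp p.2 ∈ B i := by tauto
      have h4 := h1.2.1 h3
      have h5 : ¬ η p.1 ≤ -((i : ℤ) + 1) := fun h => h2 (h1.1.2 h)
      refine ⟨if_pos (mem_bd.2 hp), ?_, h4, by omega⟩
      simp [ind, h2, h3]
    · left
      refine ⟨if_neg hp, ?_⟩
      rw [mem_bd, not_not] at hp
      simp [ind, hp]
  · rw [abs_sub_comm, abs_sub_comm (η p.1)]
    refine main _ _ hle _ _ _ fun i hi => ?_
    by_cases hp : p ∈ bd (B i)
    · right
      have h1 := hB i hi hp
      rw [mem_bd] at hp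
      have h2 : p.1 + stp p.2 ∉ B i := by
        intro hin
        have := h1.2.1 hin
        have := h1.1.2 (by omega)
        tauto
      have h3 : p.1 ∈ B i := by tauto
      have h4 := h1.1.1 h3
      have h5 : ¬ η (p.1 + stp p.2) ≤ -((i : ℤ) + 1) := fun h => h2 (h1.2.2 h)
      refine ⟨if_pos (mem_bd.2 hp), ?_, h4, by omega⟩
      simp [ind, h2, h3]
    · left
      refine ⟨if_neg hp, ?_⟩
      rw [mem_bd, not_not] at hp
      simp [ind, hp]

theorem Hm_drop {L : ℕ} (h : ℕ) (B : ℕ → Finset Site) (η : Config)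
    (hbox : ∀ i < h, B i ⊆ box L)
    (hB : ∀ i < h, ∀ p ∈ bd (B i), (p.1 ∈ B i ↔ η p.1 ≤ -((i : ℤ) + 1)) ∧
      (p.1 + stp p.2 ∈ B i ↔ η (p.1 + stp p.2) ≤ -((i : ℤ) + 1))) :
    Hm L (fun z => η z + ∑ i ∈ Finset.range h, ind (B i) z) =
      Hm L η - ∑ i ∈ Finset.range h, ((bd (B i)).card : ℤ) := by
  unfold Hm
  rw [Finset.sum_congr rfl fun p _ => edge_drop h B η p fun i hi hp => hB i hi p hp]
  rw [Finset.sum_sub_distrib, Finset.sum_comm]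
  congr 1
  exact Finset.sum_congr rfl fun i hi => sum_ind_bd (bd_sub_Ed (hbox i (Finset.mem_range.1 hi)))

/-- Fibering a product over the values of a map. -/
@[to_additive]
theorem prod_fib {M : Type*} [CommMonoid M] (x : Site) (G : Finset (Finset Site)) (h : ℕ)
    (B : ℕ → Finset Site) (hB : ∀ i < h, B i = {x} ∨ B i ∈ G) (hG : {x} ∉ G)
    (F : Finset Site → M) (hF : F {x} = 1) :
    ∏ i ∈ Finset.range h, F (B i) =
      ∏ b : G, F b.1 ^ ((Finset.range h).filter (fun i => B i = b.1)).card := by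
  have h1 : ∏ i ∈ Finset.range h, F (B i) =
      ∏ i ∈ (Finset.range h).filter (fun i => B i ∈ G), F (B i) := by
    symm
    apply Finset.prod_subset (Finset.filter_subset _ _)
    intro i hi hn
    rcases hB i (Finset.mem_range.1 hi) with h2 | h2
    · rw [h2, hF]
    · exact absurd (Finset.mem_filter.2 ⟨hi, h2⟩) hn
  rw [h1, ← Finset.prod_fiberwise_of_maps_to (t := G) (g := B)
    (fun i hi => (Finset.mem_filter.1 hi).2)]
  rw [← Finset.prod_coe_sort G (fun b => ∏ i ∈ (Finset.range h).filter (fun i => B i ∈ G) with B i = b, F (B i))]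
  refine Finset.prod_congr rfl fun b _ => ?_
  have h3 : ((Finset.range h).filter (fun i => B i ∈ G)).filter (fun i => B i = b.1) =
      (Finset.range h).filter (fun i => B i = b.1) := by
    ext i
    simp only [Finset.mem_filter]
    constructor
    · rintro ⟨⟨a, _⟩, c⟩; exact ⟨a, c⟩
    · rintro ⟨a, c⟩; exact ⟨⟨a, c ▸ b.2⟩, c⟩
  rw [h3, Finset.prod_congr rfl (g := fun _ => F b.1), Finset.prod_const]
  intro i hi
  rw [(Finset.mem_filter.1 hi).2]

/-- Constant-bound configurations. -/
def cfgN (V : Finset Site) (N : ℕ) : Finset Config := cfg V (fun _ => -(N : ℤ)) (fun _ => (N : ℤ))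

theorem mem_cfgN {V : Finset Site} {N : ℕ} {η : Config} :
    η ∈ cfgN V N ↔ (∀ x ∈ V, -(N : ℤ) ≤ η x ∧ η x ≤ N) ∧ ∀ x ∉ V, η x = 0 := mem_cfg

/-- Weight of a non-trivial set. -/
def Qw (β : ℝ) (x : Site) (B : Finset Site) : ℝ :=
  if B = {x} then 1 else Real.exp (-β * ((bd B).card - 4))

theorem tail_aux (K : ℝ) (hK : ∀ (x : Site) (𝓑 : Finset (Finset Site)),
    (∀ B ∈ 𝓑, Good B ∧ x ∈ B) → ∑ B ∈ 𝓑, Real.exp (-((bd B).card : ℝ)) ≤ K)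
    {β : ℝ} (hβ : 1 ≤ β) {L : ℕ} {V : Finset Site} (hVL : V ⊆ box L) (hV : SC V)
    {x : Site} (hx : x ∈ V) (h N : ℕ) :
    Zs β L ((cfgN V N).filter (fun η => η x ≤ -(h : ℤ))) ≤
      Real.exp (-(4 * β * h)) * Real.exp (2 * Real.exp 4 * K) * Zs β L (cfgN V (N + h)) := by
  set T := (cfgN V N).filter (fun η => η x ≤ -(h : ℤ)) with hT
  let G : Finset (Finset Site) := (V.powerset.filter (fun B => Good B ∧ x ∈ B)).erase {x}
  have hGx : {x} ∉ G := Finset.notMem_erase _ _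
  have hG : ∀ B ∈ G, Good B ∧ x ∈ B ∧ B ≠ {x} := by
    intro B hB
    have h1 := Finset.mem_erase.1 hB
    have h2 := (Finset.mem_filter.1 h1.2).2
    exact ⟨h2.1, h2.2, h1.1⟩
  have hex : ∀ η : Config, ∃ B : ℕ → Finset Site, η ∈ T → ∀ i < h, B i ⊆ V ∧ x ∈ B i ∧ Good (B i) ∧
      ∀ p ∈ bd (B i), (p.1 ∈ B i ↔ η p.1 ≤ -((i : ℤ) + 1)) ∧
        (p.1 + stp p.2 ∈ B i ↔ η (p.1 + stp p.2) ≤ -((i : ℤ) + 1)) := by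
    intro η
    by_cases hη : η ∈ T
    · have h1 : ∀ i : ℕ, ∃ B : Finset Site, i < h → B ⊆ V ∧ x ∈ B ∧ Good B ∧
        ∀ p ∈ bd B, (p.1 ∈ B ↔ η p.1 ≤ -((i : ℤ) + 1)) ∧
          (p.1 + stp p.2 ∈ B ↔ η (p.1 + stp p.2) ≤ -((i : ℤ) + 1)) := by
        intro i
        by_cases hi : i < h
        · have hη' := Finset.mem_filter.1 hη
          have hc := mem_cfgN.1 hη'.1
          obtain ⟨B, hB⟩ := exists_good hV (x := x) (P := fun z => η z ≤ -((i : ℤ) + 1))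
            (by
              intro z hz
              by_contra hzV
              have := hc.2 z hzV
              omega) (by have := hη'.2; omega)
          exact ⟨B, fun _ => hB⟩
        · exact ⟨∅, fun h => absurd h hi⟩
      choose B hB using h1
      exact ⟨B, fun _ i hi => hB i hi⟩
    · exact ⟨fun _ => ∅, fun h => absurd h hη⟩
  choose B hB using hex
  have hBG : ∀ η ∈ T, ∀ i < h, B η i = {x} ∨ B η i ∈ G := by
    intro η hη i hi
    obtain ⟨h1, h2, h3, -⟩ := hB η hη i hi
    by_cases h4 : B η i = {x}
    · exact Or.inl h4
    · exact Or.inr (Finset.mem_erase.2 ⟨h4, Finset.mem_filter.2 ⟨Finset.mem_powerset.2 h1, h3, h2⟩⟩)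
  let η' : Config → Config := fun η z => η z + ∑ i ∈ Finset.range h, ind (B η i) z
  let m : Config → G → ℕ := fun η b => ((Finset.range h).filter (fun i => B η i = b.1)).card
  have hinj : ∀ η1 ∈ T, ∀ η2 ∈ T, (η' η1, m η1) = (η' η2, m η2) → η1 = η2 := by
    intro η1 h1 η2 h2 heq
    obtain ⟨e1, e2⟩ := Prod.mk.inj heq
    funext y
    have key : ∀ η ∈ T, ∑ i ∈ Finset.range h, ind (B η i) y =
        ∑ b : G, m η b • (ind b.1 y - ind {x} y) + h * ind {x} y := by
      intro η hη
      have h3 := sum_fib x G h (B η) (hBG η hη) hGx (fun B => ind B y - ind {x} y) (by simp)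
      rw [Finset.sum_sub_distrib] at h3
      simp only [Finset.sum_const, Finset.card_range, nsmul_eq_mul] at h3
      simp only [nsmul_eq_mul]
      linarith
    have h3 := congrFun e1 y
    simp only [η'] at h3
    rw [key η1 h1, key η2 h2, e2] at h3
    linarith
  have hwt : ∀ η ∈ T, wt β L η ≤
      Real.exp (-(4 * β * h)) * ((∏ b : G, Qw β x b.1 ^ m η b) * wt β L (η' η)) := by
    intro η hη
    have hd := Hm_drop (L := L) h (B η) η (fun i hi => (hB η hη i hi).1.trans hVL)
      (fun i hi => (hB η hη i hi).2.2.2)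
    have hw : wt β L η = wt β L (η' η) * ∏ i ∈ Finset.range h, Real.exp (-β * (bd (B η i)).card) := by
      unfold wt
      rw [← Real.exp_sum, ← Real.exp_add]
      congr 1
      rw [hd, ← Finset.mul_sum]
      push_cast
      ring
    have hp : ∏ i ∈ Finset.range h, Real.exp (-β * (bd (B η i)).card) ≤
        ∏ i ∈ Finset.range h, (Real.exp (-(4 * β)) * Qw β x (B η i)) := by
      refine Finset.prod_le_prod (fun _ _ => (Real.exp_pos _).le) fun i hi => ?_
      have hi := Finset.mem_range.1 hi
      have h4 : (4 : ℝ) ≤ (bd (B η i)).card := by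
        exact_mod_cast bd_card_four ⟨x, (hB η hη i hi).2.1⟩
      unfold Qw
      split_ifs
      · rw [mul_one, Real.exp_le_exp]; nlinarith
      · rw [← Real.exp_add, Real.exp_le_exp]; nlinarith
    rw [Finset.prod_mul_distrib, Finset.prod_const, Finset.card_range, ← Real.exp_nat_mul,
      prod_fib x G h (B η) (hBG η hη) hGx (Qw β x) (by simp [Qw])] at hp
    rw [hw]
    have := mul_le_mul_of_nonneg_left hp (wt_pos β L (η' η)).le
    refine this.trans (le_of_eq ?_)
    have : (h : ℝ) * -(4 * β) = -(4 * β * h) := by ring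
    rw [this]
    ring
  have hQ0 : ∀ b : G, 0 ≤ Qw β x b.1 := by
    intro b; unfold Qw; split_ifs
    · norm_num
    · exact (Real.exp_pos _).le
  have hmaps : ∀ η ∈ T, (η' η, m η) ∈ cfgN V (N + h) ×ˢ
      Fintype.piFinset (fun _ : G => Finset.range (h + 1)) := by
    intro η hη
    have hη' := mem_cfgN.1 (Finset.mem_filter.1 hη).1
    rw [Finset.mem_product]
    constructor
    · rw [mem_cfgN]
      have hs : ∀ z, 0 ≤ ∑ i ∈ Finset.range h, ind (B η i) z ∧
          ∑ i ∈ Finset.range h, ind (B η i) z ≤ h := by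
        intro z
        constructor
        · exact Finset.sum_nonneg fun i _ => by unfold ind; split_ifs <;> norm_num
        · have : ∑ i ∈ Finset.range h, ind (B η i) z ≤ ∑ i ∈ Finset.range h, (1 : ℤ) :=
            Finset.sum_le_sum fun i _ => by unfold ind; split_ifs <;> norm_num
          simpa using this
      constructor
      · intro z hz
        have h1 := hη'.1 z hz
        have h2 := hs z
        simp only [η']
        push_cast
        omega
      · intro z hz
        simp only [η']
        rw [hη'.2 z hz, zero_add]
        refine Finset.sum_eq_zero fun i hi => ?_
        unfold ind
        rw [if_neg]
        exact fun h1 => hz ((hB η hη i (Finset.mem_range.1 hi)).1 h1)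
    · rw [Fintype.mem_piFinset]
      intro b
      rw [Finset.mem_range, Nat.lt_succ_iff]
      exact (Finset.card_filter_le _ _).trans (le_of_eq (Finset.card_range h))
  let W : Config × (G → ℕ) → ℝ := fun q => (∏ b : G, Qw β x b.1 ^ q.2 b) * wt β L q.1
  have hW0 : ∀ q, 0 ≤ W q := fun q =>
    mul_nonneg (Finset.prod_nonneg fun b _ => pow_nonneg (hQ0 b) _) (wt_pos _ _ _).le
  have hsum : ∑ η ∈ T, W (η' η, m η) ≤ ∑ q ∈ cfgN V (N + h) ×ˢ
      Fintype.piFinset (fun _ : G => Finset.range (h + 1)), W q := by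
    rw [← Finset.sum_image (g := fun η => (η' η, m η)) (f := W) (s := T)
      (fun a ha b hb hab => hinj a ha b hb hab)]
    refine Finset.sum_le_sum_of_subset_of_nonneg ?_ fun q _ _ => hW0 q
    intro q hq
    obtain ⟨η, hη, rfl⟩ := Finset.mem_image.1 hq
    exact hmaps η hη
  have hprod : ∑ q ∈ cfgN V (N + h) ×ˢ
      Fintype.piFinset (fun _ : G => Finset.range (h + 1)), W q =
      (∏ b : G, ∑ j ∈ Finset.range (h + 1), Qw β x b.1 ^ j) * Zs β L (cfgN V (N + h)) := by
    rw [Finset.prod_univ_sum, Finset.sum_product_right, Finset.sum_mul]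
    refine Finset.sum_congr rfl fun f _ => ?_
    unfold Zs
    rw [Finset.mul_sum]
  have hgeo : ∏ b : G, ∑ j ∈ Finset.range (h + 1), Qw β x b.1 ^ j ≤ Real.exp (2 * Real.exp 4 * K) := by
    have h1 : ∀ b : G, ∑ j ∈ Finset.range (h + 1), Qw β x b.1 ^ j ≤
        Real.exp (2 * (Real.exp 4 * Real.exp (-((bd b.1).card : ℝ)))) := by
      intro b
      obtain ⟨-, h2, h3⟩ := hG b.1 b.2
      have h6 : (6 : ℝ) ≤ (bd b.1).card := by exact_mod_cast bd_card_six h2 h3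
      have hq : Qw β x b.1 ≤ Real.exp 4 * Real.exp (-((bd b.1).card : ℝ)) := by
        unfold Qw
        rw [if_neg h3, ← Real.exp_add, Real.exp_le_exp]
        nlinarith
      set q := Qw β x b.1
      have hq2 : q ≤ 1 / 2 := by
        refine hq.trans ?_
        rw [← Real.exp_add]
        have h7 : Real.exp (4 + -((bd b.1).card : ℝ)) ≤ Real.exp (-1) := by
          rw [Real.exp_le_exp]; linarith
        refine h7.trans ?_
        rw [Real.exp_neg, inv_eq_one_div]
        have := Real.add_one_le_exp 1
        apply one_div_le_one_div_of_le <;> linarith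
      have hq0 : 0 ≤ q := hQ0 b
      have h8 : ∑ j ∈ Finset.range (h + 1), q ^ j ≤ 1 + 2 * q := by
        have h9 := geom_sum_mul_neg q (h + 1)
        have h10 : 0 ≤ q ^ (h + 1) := pow_nonneg hq0 _
        have h11 : (∑ j ∈ Finset.range (h + 1), q ^ j) * (1 - q) ≤ 1 := by linarith
        have h12 : 0 ≤ ∑ j ∈ Finset.range (h + 1), q ^ j :=
          Finset.sum_nonneg fun _ _ => pow_nonneg hq0 _
        by_contra hcon
        push Not at hcon
        nlinarith
      have h13 := Real.add_one_le_exp (2 * q)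
      calc _ ≤ 1 + 2 * q := h8
        _ ≤ Real.exp (2 * q) := by linarith
        _ ≤ _ := by rw [Real.exp_le_exp]; linarith
    refine (Finset.prod_le_prod (fun b _ => Finset.sum_nonneg fun _ _ => pow_nonneg (hQ0 b) _)
      (fun b _ => h1 b)).trans ?_
    rw [← Real.exp_sum, Real.exp_le_exp, ← Finset.mul_sum, ← Finset.mul_sum]
    rw [Finset.sum_coe_sort G (fun b => Real.exp (-((bd b).card : ℝ)))]
    have := hK x G fun B hB => ⟨(hG B hB).1, (hG B hB).2.1⟩
    have h5 := Real.exp_pos 4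
    nlinarith
  calc Zs β L T ≤ ∑ η ∈ T, Real.exp (-(4 * β * h)) * W (η' η, m η) := Finset.sum_le_sum hwt
    _ = Real.exp (-(4 * β * h)) * ∑ η ∈ T, W (η' η, m η) := by rw [Finset.mul_sum]
    _ ≤ Real.exp (-(4 * β * h)) * (Real.exp (2 * Real.exp 4 * K) * Zs β L (cfgN V (N + h))) := by
        refine mul_le_mul_of_nonneg_left ?_ (Real.exp_pos _).le
        rw [hprod] at hsum
        exact hsum.trans (mul_le_mul_of_nonneg_right hgeo (Zs_nonneg _ _ _))
    _ = _ := by ring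

theorem cfg_card (V : Finset Site) (N : ℕ) : (cfgN V N).card ≤ (2 * N + 1) ^ V.card := by
  unfold cfgN cfg
  refine Finset.card_image_le.trans ?_
  rw [Finset.card_pi, Finset.prod_const, Int.card_Icc]
  apply le_of_eq
  congr 1
  omega

theorem Zs_one (β : ℝ) (L : ℕ) (V : Finset Site) (N : ℕ) : 1 ≤ Zs β L (cfgN V N) := by
  have h0 : (0 : Config) ∈ cfgN V N := by
    rw [mem_cfgN]; exact ⟨fun x _ => by simp, fun _ _ => rfl⟩
  have h1 : wt β L 0 = 1 := by simp [wt, Hm]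
  unfold Zs
  rw [← h1]
  exact Finset.single_le_sum (f := fun η => wt β L η) (fun η _ => (wt_pos β L η).le) h0

theorem exists_N {β : ℝ} (hβ : 1 ≤ β) (L : ℕ) (V : Finset Site) (h N0 : ℕ) :
    ∃ N, N0 ≤ N ∧ Zs β L (cfgN V (N + h)) ≤ 2 * Zs β L (cfgN V N) := by
  by_contra hcon
  push Not at hcon
  have h1 : ∀ k : ℕ, (2 : ℝ) ^ k ≤ Zs β L (cfgN V (N0 + k * h)) := by
    intro k
    induction k with
    | zero => simpa using Zs_one β L V N0
    | succ k ih =>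
      have := hcon (N0 + k * h) (by omega)
      rw [show N0 + (k + 1) * h = N0 + k * h + h by ring, pow_succ]
      linarith
  have h2 : ∀ N, Zs β L (cfgN V N) ≤ ((2 * N + 1 : ℕ) : ℝ) ^ V.card := by
    intro N
    have : Zs β L (cfgN V N) ≤ ∑ η ∈ cfgN V N, (1 : ℝ) :=
      Finset.sum_le_sum fun η _ => wt_le_one hβ L η
    refine this.trans ?_
    simp only [Finset.sum_const, nsmul_eq_mul, mul_one]
    exact_mod_cast cfg_card V N
  have h3 : ∀ k : ℕ, 1 ≤ k → (2 : ℝ) ^ k ≤ ((2 * N0 + 2 * h + 1 : ℕ) : ℝ) ^ V.card * (k : ℝ) ^ V.card := by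
    intro k hk
    refine (h1 k).trans ((h2 _).trans ?_)
    rw [← mul_pow]
    apply pow_le_pow_left₀ (by positivity)
    have : 2 * (N0 + k * h) + 1 ≤ (2 * N0 + 2 * h + 1) * k := by nlinarith
    exact_mod_cast this
  have ht := tendsto_pow_const_div_const_pow_of_one_lt V.card (r := 2) (by norm_num)
  set c : ℝ := ((2 * N0 + 2 * h + 1 : ℕ) : ℝ) ^ V.card with hc
  have hc0 : 0 < c := by positivity
  have hev := (ht.eventually (gt_mem_nhds (show (0 : ℝ) < 1 / c by positivity))).and
    (eventually_ge_atTop 1)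
  obtain ⟨k, hk1, hk2⟩ := hev.exists
  have := h3 k hk2
  rw [div_lt_div_iff₀ (by positivity) hc0] at hk1
  linarith

theorem Hm_neg (L : ℕ) (η : Config) : Hm L (-η) = Hm L η := by
  unfold Hm
  refine Finset.sum_congr rfl fun p _ => ?_
  simp only [Pi.neg_apply]
  rw [← abs_neg]
  congr 1
  ring

theorem tail_half (β : ℝ) (L : ℕ) (V : Finset Site) (x : Site) (h N : ℕ) (hh : 1 ≤ h) :
    2 * Zs β L ((cfgN V N).filter (fun η => η x ≤ -(h : ℤ))) ≤ Zs β L (cfgN V N) := by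
  have h1 : Zs β L ((cfgN V N).filter (fun η => η x ≤ -(h : ℤ))) =
      Zs β L ((cfgN V N).filter (fun η => (h : ℤ) ≤ η x)) := by
    unfold Zs
    refine Finset.sum_nbij' (fun η => -η) (fun η => -η) ?_ ?_ ?_ ?_ ?_
    · intro η hη
      rw [Finset.mem_filter, mem_cfgN] at hη ⊢
      refine ⟨⟨fun z hz => ?_, fun z hz => ?_⟩, ?_⟩
      · have := hη.1.1 z hz; simp only [Pi.neg_apply]; omega
      · simp [hη.1.2 z hz]
      · simp only [Pi.neg_apply]; omega
    · intro η hη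
      rw [Finset.mem_filter, mem_cfgN] at hη ⊢
      refine ⟨⟨fun z hz => ?_, fun z hz => ?_⟩, ?_⟩
      · have := hη.1.1 z hz; simp only [Pi.neg_apply]; omega
      · simp [hη.1.2 z hz]
      · simp only [Pi.neg_apply]; omega
    · intro η _; simp
    · intro η _; simp
    · intro η _
      unfold wt
      rw [Hm_neg]
  have h2 : Disjoint ((cfgN V N).filter (fun η => η x ≤ -(h : ℤ)))
      ((cfgN V N).filter (fun η => (h : ℤ) ≤ η x)) := by
    rw [Finset.disjoint_filter]
    intro η _ h3 h4
    omega
  calc _ = Zs β L ((cfgN V N).filter (fun η => η x ≤ -(h : ℤ)) ∪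
        (cfgN V N).filter (fun η => (h : ℤ) ≤ η x)) := by
        rw [two_mul]
        nth_rw 2 [h1]
        unfold Zs
        rw [Finset.sum_union h2]
    _ ≤ _ := Zs_mono _ _ (Finset.union_subset (Finset.filter_subset _ _) (Finset.filter_subset _ _))

theorem tail : ∃ C : ℝ, 0 < C ∧ ∀ β : ℝ, 1 ≤ β → ∀ (L : ℕ) (V : Finset Site), V ⊆ box L → SC V →
    ∀ h N0 : ℕ, 1 ≤ h → ∃ N, N0 ≤ N ∧ ∀ x ∈ V,
      Zs β L ((cfgN V N).filter (fun η => η x ≤ -(h : ℤ))) ≤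
        C * Real.exp (-(4 * β * h)) * Zs β L (cfgN V N) ∧
      2 * Zs β L ((cfgN V N).filter (fun η => η x ≤ -(h : ℤ))) ≤ Zs β L (cfgN V N) := by
  obtain ⟨K, -, hK⟩ := good_sum
  refine ⟨2 * Real.exp (2 * Real.exp 4 * K), by positivity, ?_⟩
  intro β hβ L V hVL hV h N0 hh
  obtain ⟨N, hN, hN2⟩ := exists_N hβ L V h N0
  refine ⟨N, hN, fun x hx => ⟨?_, tail_half β L V x h N hh⟩⟩
  refine (tail_aux K hK hβ hVL hV hx h N).trans ?_
  have h1 : 0 < Real.exp (-(4 * β * h)) * Real.exp (2 * Real.exp 4 * K) := by positivity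
  have := mul_le_mul_of_nonneg_left hN2 h1.le
  linarith

open scoped FinsetFamily

theorem wt_mul_le {β : ℝ} (hβ : 1 ≤ β) {L : ℕ} {a b c d : Config}
    (h : Hm L c + Hm L d ≤ Hm L a + Hm L b) : wt β L a * wt β L b ≤ wt β L c * wt β L d := by
  unfold wt
  rw [← Real.exp_add, ← Real.exp_add, Real.exp_le_exp]
  have : (Hm L c : ℝ) + Hm L d ≤ Hm L a + Hm L b := by exact_mod_cast h
  nlinarith

theorem Hm_add_le {L : ℕ} {a b c d : Config}
    (h : ∀ z w : Site, |c z - c w| + |d z - d w| ≤ |a z - a w| + |b z - b w|) :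
    Hm L c + Hm L d ≤ Hm L a + Hm L b := by
  unfold Hm
  rw [← Finset.sum_add_distrib, ← Finset.sum_add_distrib]
  exact Finset.sum_le_sum fun p _ => h _ _

theorem lat_le {β : ℝ} (hβ : 1 ≤ β) (L : ℕ) (s t u v : Finset Config)
    (hu : ∀ a ∈ s, ∀ b ∈ t, a ⊓ b ∈ u) (hv : ∀ a ∈ s, ∀ b ∈ t, a ⊔ b ∈ v) :
    Zs β L s * Zs β L t ≤ Zs β L u * Zs β L v := by
  have h0 : (0 : Config → ℝ) ≤ wt β L := fun _ => (wt_pos _ _ _).le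
  have h := four_functions_theorem (wt β L) (wt β L) (wt β L) (wt β L) h0 h0 h0 h0 (by
    intro a b
    refine wt_mul_le hβ (Hm_add_le fun z w => ?_)
    simp only [Pi.inf_apply, Pi.sup_apply]
    simp only [abs_eq_max_neg]
    omega) s t
  refine h.trans ?_
  refine mul_le_mul (Zs_mono β L ?_) (Zs_mono β L ?_) (Zs_nonneg _ _ _) (Zs_nonneg _ _ _)
  · intro c hc
    obtain ⟨a, ha, b, hb, rfl⟩ := Finset.mem_infs.1 hc
    exact hu a ha b hb
  · intro c hc
    obtain ⟨a, ha, b, hb, rfl⟩ := Finset.mem_sups.1 hc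
    exact hv a ha b hb

theorem shift_le {β : ℝ} (hβ : 1 ≤ β) (L : ℕ) (V : Finset Site) (s t u v : Finset Config)
    (hs : ∀ a ∈ s, ∀ z ∉ V, a z = 0) (ht : ∀ a ∈ t, ∀ z ∉ V, a z = 0)
    (hu : ∀ a ∈ s, ∀ b ∈ t, (fun z => if z ∈ V then min (a z + 1) (b z) else 0) ∈ u)
    (hv : ∀ a ∈ s, ∀ b ∈ t, (fun z => if z ∈ V then max (a z) (b z - 1) else 0) ∈ v) :
    Zs β L s * Zs β L t ≤ Zs β L u * Zs β L v := by
  let g : Config → ℝ := fun a => if ∀ z ∉ V, a z = 0 then wt β L a else 0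
  let f : Config → ℝ := fun a => if ∀ z ∉ V, a z = 0 then wt β L (a - ind V) else 0
  have hg : 0 ≤ g := fun a => by
    simp only [g, Pi.zero_apply]; split_ifs
    · exact (wt_pos _ _ _).le
    · exact le_rfl
  have hf : 0 ≤ f := fun a => by
    simp only [f, Pi.zero_apply]; split_ifs
    · exact (wt_pos _ _ _).le
    · exact le_rfl
  have h := four_functions_theorem f g g f hf hg hg hf (by
    intro a b
    by_cases ha : ∀ z ∉ V, a z = 0
    · by_cases hb : ∀ z ∉ V, b z = 0
      · have h1 : ∀ z ∉ V, (a ⊓ b) z = 0 := fun z hz => by simp [ha z hz, hb z hz]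
        have h2 : ∀ z ∉ V, (a ⊔ b) z = 0 := fun z hz => by simp [ha z hz, hb z hz]
        simp only [f, g]
        rw [if_pos ha, if_pos hb, if_pos h1, if_pos h2]
        refine wt_mul_le hβ (Hm_add_le fun z w => ?_)
        simp only [Pi.inf_apply, Pi.sup_apply, Pi.sub_apply, ind]
        have a1 := ha z; have a2 := ha w; have b1 := hb z; have b2 := hb w
        by_cases hz : z ∈ V <;> by_cases hw : w ∈ V
        · simp only [hz, hw, if_true, abs_eq_max_neg]; omega
        · rw [a2 hw, b2 hw]; simp only [hz, hw, if_true, if_false, abs_eq_max_neg]; omega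
        · rw [a1 hz, b1 hz]; simp only [hz, hw, if_true, if_false, abs_eq_max_neg]; omega
        · rw [a1 hz, b1 hz, a2 hw, b2 hw]; simp
      · simp only [g]
        rw [if_neg hb, mul_zero]
        exact mul_nonneg (hg _) (hf _)
    · simp only [f]
      rw [if_neg ha, zero_mul]
      exact mul_nonneg (hg _) (hf _)) (s.image (fun a => a + ind V)) t
  have e1 : ∑ a ∈ s.image (fun a => a + ind V), f a = Zs β L s := by
    rw [Finset.sum_image (fun a _ b _ hab => add_right_cancel hab)]
    refine Finset.sum_congr rfl fun a ha => ?_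
    simp only [f]
    rw [if_pos (fun z hz => by simp [ind, hz, hs a ha z hz]), add_sub_cancel_right]
  have e2 : ∑ a ∈ t, g a = Zs β L t := by
    refine Finset.sum_congr rfl fun a ha => ?_
    simp only [g]
    rw [if_pos (fun z hz => by simp [ht a ha z hz])]
  rw [e1, e2] at h
  refine h.trans ?_
  have hfun : ∀ (a b : Config), (∀ z ∉ V, a z = 0) → (∀ z ∉ V, b z = 0) →
      ((a + ind V) ⊓ b = fun z => if z ∈ V then min (a z + 1) (b z) else 0) ∧
      ((a + ind V) ⊔ b - ind V = fun z => if z ∈ V then max (a z) (b z - 1) else 0) := by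
    intro a b ha hb
    constructor
    · funext z
      by_cases hz : z ∈ V
      · simp [ind, hz]
      · simp [ind, hz, ha z hz, hb z hz]
    · funext z
      by_cases hz : z ∈ V
      · simp only [Pi.sub_apply, Pi.sup_apply, Pi.add_apply, ind, hz, if_true]; omega
      · simp [ind, hz, ha z hz, hb z hz]
  refine mul_le_mul ?_ ?_ (Finset.sum_nonneg fun a _ => hf a) (Zs_nonneg _ _ _)
  · have h1 : ∑ a ∈ s.image (fun a => a + ind V) ⊼ t, g a ≤
        ∑ a ∈ s.image (fun a => a + ind V) ⊼ t, wt β L a := by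
      refine Finset.sum_le_sum fun a _ => ?_
      simp only [g]; split_ifs
      · exact le_rfl
      · exact (wt_pos _ _ _).le
    refine h1.trans (Zs_mono β L ?_)
    intro c hc
    obtain ⟨a, ha, b, hb, rfl⟩ := Finset.mem_infs.1 hc
    obtain ⟨a, ha', rfl⟩ := Finset.mem_image.1 ha
    rw [(hfun a b (hs a ha') (ht b hb)).1]
    exact hu a ha' b hb
  · have h1 : ∑ a ∈ s.image (fun a => a + ind V) ⊻ t, f a ≤
        ∑ a ∈ s.image (fun a => a + ind V) ⊻ t, wt β L (a - ind V) := by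
      refine Finset.sum_le_sum fun a _ => ?_
      simp only [f]; split_ifs
      · exact le_rfl
      · exact (wt_pos _ _ _).le
    refine h1.trans ?_
    rw [← Finset.sum_image (f := wt β L) (g := fun a => a - ind V)
      (fun a _ b _ hab => sub_left_injective hab)]
    refine Zs_mono β L ?_
    intro c hc
    obtain ⟨c, hc', rfl⟩ := Finset.mem_image.1 hc
    obtain ⟨a, ha, b, hb, rfl⟩ := Finset.mem_sups.1 hc'
    obtain ⟨a, ha', rfl⟩ := Finset.mem_image.1 ha
    show (a + ind V) ⊔ b - ind V ∈ v
    rw [(hfun a b (hs a ha') (ht b hb)).2]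
    exact hv a ha' b hb

/-- Floors. -/
def flo (D : Finset Site) (h : ℕ) : Site → ℤ := fun x => if x ∈ D then 0 else -(h : ℤ)

theorem floor_raise {β : ℝ} (hβ : 1 ≤ β) {L : ℕ} {V V0 D : Finset Site} (h0 : V0 ⊆ V)
    (hD : ∀ x ∈ V, x ∉ V0 → x ∈ D) {h N : ℕ} (hh : 1 ≤ h) (hN : h ≤ N) {u : ℝ} (hu0 : 0 ≤ u)
    (hu : ∀ x ∈ V0, Zs β L ((cfgN V0 N).filter (fun η => η x ≤ -(h : ℤ))) ≤ u * Zs β L (cfgN V0 N) ∧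
      2 * Zs β L ((cfgN V0 N).filter (fun η => η x ≤ -(h : ℤ))) ≤ Zs β L (cfgN V0 N)) 
    (T : Finset Site) (hT : T ⊆ V \ D) :
    Zs β L (cfg V (flo D h) (fun _ => N)) ≤ Real.exp (2 * u * T.card) *
      Zs β L (cfg V (fun x => if x ∈ T then -(h : ℤ) + 1 else flo D h x) (fun _ => N)) := by
  induction T using Finset.induction_on with
  | empty => simp
  | insert x T hxT ih =>
    have hx := Finset.mem_sdiff.1 (hT (Finset.mem_insert_self x T))
    have hx0 : x ∈ V0 := by
      by_contra hn
      exact hx.2 (hD x hx.1 hn)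
    have ih := ih ((Finset.subset_insert _ _).trans hT)
    refine ih.trans ?_
    obtain ⟨hu1, hu2⟩ := hu x hx0
    set Zt := Zs β L ((cfgN V0 N).filter (fun η => η x ≤ -(h : ℤ))) with hZt
    set Za := Zs β L (cfgN V0 N) with hZa
    have hZa1 : 1 ≤ Za := Zs_one _ _ _ _
    have hcompl : Zs β L ((cfgN V0 N).filter (fun η => ¬ η x ≤ -(h : ℤ))) = Za - Zt := by
      rw [hZa, hZt]
      unfold Zs
      rw [← Finset.sum_filter_add_sum_filter_not (cfgN V0 N) (fun η => η x ≤ -(h : ℤ))]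
      ring
    have hlat := lat_le hβ L (cfg V (fun y => if y ∈ T then -(h : ℤ) + 1 else flo D h y) (fun _ => N))
      ((cfgN V0 N).filter (fun η => ¬ η x ≤ -(h : ℤ))) (cfgN V0 N)
      (cfg V (fun y => if y ∈ insert x T then -(h : ℤ) + 1 else flo D h y) (fun _ => N))
      (by
        intro a ha b hb
        rw [mem_cfg] at ha
        rw [Finset.mem_filter, mem_cfgN] at hb
        rw [mem_cfgN]
        constructor
        · intro y hy
          have h1 := ha.1 y (h0 hy)
          have h2 := hb.1.1 y hy
          have h3 : -(N : ℤ) ≤ a y := by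
            refine le_trans ?_ h1.1
            unfold flo
            split_ifs <;> omega
          simp only [Pi.inf_apply]
          omega
        · intro y hy
          have h2 := hb.1.2 y hy
          simp only [Pi.inf_apply, h2]
          by_cases hyV : y ∈ V
          · have h1 := ha.1 y hyV
            have hyD := hD y hyV hy
            have hyT : y ∉ T := fun hyT =>
              (Finset.mem_sdiff.1 (hT (Finset.mem_insert_of_mem hyT))).2 hyD
            simp only [hyT, if_false, flo, hyD, if_true] at h1
            omega
          · have h1 := ha.2 y hyV
            omega)
      (by
        intro a ha b hb
        rw [mem_cfg] at ha
        rw [Finset.mem_filter, mem_cfgN] at hb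
        rw [mem_cfg]
        constructor
        · intro y hy
          have h1 := ha.1 y hy
          have h2 : b y ≤ N := by
            by_cases hy0 : y ∈ V0
            · exact (hb.1.1 y hy0).2
            · rw [hb.1.2 y hy0]; omega
          simp only [Pi.sup_apply, Finset.mem_insert]
          refine ⟨?_, by omega⟩
          by_cases hyx : y = x
          · subst hyx
            simp only [true_or, if_true]
            have := hb.2
            omega
          · simp only [hyx, false_or]
            exact h1.1.trans (le_max_left _ _)
        · intro y hy
          have h1 := ha.2 y hy
          have h2 := hb.1.2 y (fun h => hy (h0 h))
          simp [h1, h2])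
    rw [hcompl] at hlat
    set A := Zs β L (cfg V (fun y => if y ∈ T then -(h : ℤ) + 1 else flo D h y) (fun _ => N))
    set A' := Zs β L (cfg V (fun y => if y ∈ insert x T then -(h : ℤ) + 1 else flo D h y) (fun _ => N))
    have hA' : 0 ≤ A' := Zs_nonneg _ _ _
    have hA : 0 ≤ A := Zs_nonneg _ _ _
    have hZt0 : 0 ≤ Zt := Zs_nonneg _ _ _
    have hkey : A ≤ Real.exp (2 * u) * A' := by
      have h1 := Real.add_one_le_exp (2 * u)
      have h2 : Za ≤ (1 + 2 * u) * (Za - Zt) := by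
        by_cases hu3 : u ≤ 1 / 2
        · nlinarith
        · nlinarith
      have h3 : A * (Za - Zt) ≤ ((1 + 2 * u) * A') * (Za - Zt) := by nlinarith
      have h4 : 0 < Za - Zt := by linarith
      have h5 := le_of_mul_le_mul_right h3 h4
      nlinarith
    rw [Finset.card_insert_of_notMem hxT]
    push_cast
    have e : Real.exp (2 * u * (T.card + 1)) = Real.exp (2 * u * T.card) * Real.exp (2 * u) := by
      rw [← Real.exp_add]; ring_nf
    rw [e, mul_assoc (Real.exp (2 * u * T.card))]
    exact mul_le_mul_of_nonneg_left hkey (Real.exp_pos _).le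

theorem ratio : ∃ C : ℝ, 0 < C ∧ ∀ β : ℝ, 1 ≤ β → ∀ (L : ℕ) (V V0 D : Finset Site), V ⊆ box L →
    V0 ⊆ V → SC V0 → (∀ x ∈ V, x ∉ V0 → x ∈ D) → ∀ (h : ℕ) (m : ℤ), 
      Zs β L (cfg V (flo D (h + 1)) (fun _ => m)) ≤
        Real.exp (C * V.card * Real.exp (-(4 * β * (h + 1 : ℕ)))) *
          Zs β L (cfg V (flo D h) (fun _ => m + 1)) := by
  obtain ⟨C, hC, htail⟩ := tail
  refine ⟨2 * C, by positivity, ?_⟩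
  intro β hβ L V V0 D hVL h0 hSC hD h m
  obtain ⟨N, hN, hx⟩ := htail β hβ L V0 (h0.trans hVL) hSC (h + 1) (h + 1 + m.toNat) (by omega)
  have hr := floor_raise hβ h0 hD (by omega) (by omega : h + 1 ≤ N)
    (u := C * Real.exp (-(4 * β * (h + 1 : ℕ)))) (by positivity) hx (V \ D) (le_refl _)
  have hcfg : cfg V (fun x => if x ∈ V \ D then -((h + 1 : ℕ) : ℤ) + 1 else flo D (h + 1) x)
      (fun _ => (N : ℤ)) ⊆ cfg V (flo D h) (fun _ => N) := by
    intro η hη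
    rw [mem_cfg] at hη ⊢
    refine ⟨fun y hy => ⟨?_, (hη.1 y hy).2⟩, hη.2⟩
    have := (hη.1 y hy).1
    by_cases hyD : y ∈ D
    · simpa [hyD, flo, hy] using this
    · simpa [hyD, flo, hy] using this
  have hs := shift_le hβ L V (cfg V (flo D (h + 1)) (fun _ => m)) (cfg V (flo D h) (fun _ => N))
    (cfg V (flo D h) (fun _ => m + 1)) (cfg V (flo D (h + 1)) (fun _ => N))
    (fun a ha => (mem_cfg.1 ha).2) (fun a ha => (mem_cfg.1 ha).2)
    (by
      intro a ha b hb
      rw [mem_cfg] at ha hb ⊢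
      refine ⟨fun y hy => ?_, fun y hy => by simp [hy]⟩
      have h1 := ha.1 y hy
      have h2 := hb.1 y hy
      simp only [hy, if_true]
      unfold flo at *
      split_ifs at * <;> push_cast at * <;> omega)
    (by
      intro a ha b hb
      rw [mem_cfg] at ha hb ⊢
      refine ⟨fun y hy => ?_, fun y hy => by simp [hy]⟩
      have h1 := ha.1 y hy
      have h2 := hb.1 y hy
      simp only [hy, if_true]
      unfold flo at *
      split_ifs at * <;> push_cast at * <;> omega)
  set A := Zs β L (cfg V (flo D (h + 1)) (fun _ => m))
  set B := Zs β L (cfg V (flo D h) (fun _ => (N : ℤ)))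
  set C' := Zs β L (cfg V (flo D h) (fun _ => m + 1))
  set E := Zs β L (cfg V (flo D (h + 1)) (fun _ => (N : ℤ)))
  have hB : 0 < B := by
    have h1 : (0 : Config) ∈ cfg V (flo D h) (fun _ => (N : ℤ)) := by
      rw [mem_cfg]
      refine ⟨fun y _ => ?_, fun _ _ => rfl⟩
      simp only [Pi.zero_apply, flo]
      split_ifs <;> omega
    exact Finset.sum_pos (fun _ _ => wt_pos _ _ _) ⟨_, h1⟩
  have hE : E ≤ Real.exp (2 * C * V.card * Real.exp (-(4 * β * (h + 1 : ℕ)))) * B := by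
    refine hr.trans ?_
    refine mul_le_mul ?_ (Zs_mono β L hcfg) (Zs_nonneg _ _ _) (Real.exp_pos _).le
    rw [Real.exp_le_exp]
    have h1 : ((V \ D).card : ℝ) ≤ V.card := by
      exact_mod_cast Finset.card_le_card Finset.sdiff_subset
    have h2 : 0 < C * Real.exp (-(4 * β * (h + 1 : ℕ))) := by positivity
    nlinarith
  have hC' : 0 ≤ C' := Zs_nonneg _ _ _
  have := mul_le_mul_of_nonneg_left hE hC'
  refine le_of_mul_le_mul_right ?_ hB
  linarith

/-! ### Part 5: geometry of contours -/

/-- Triangular adjacency. -/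
def Tri (x y : Site) : Prop :=
  y = (x.1 + 1, x.2) ∨ y = (x.1 - 1, x.2) ∨ y = (x.1, x.2 + 1) ∨ y = (x.1, x.2 - 1) ∨
    y = (x.1 + 1, x.2 + 1) ∨ y = (x.1 - 1, x.2 - 1)

theorem Tri.symm {x y : Site} (h : Tri x y) : Tri y x := by
  rcases x with ⟨a, b⟩; rcases y with ⟨c, d⟩
  simp only [Tri, Prod.mk.injEq] at *
  omega

theorem mem_edgeSites {e : DualV × DualV} {x : Site} :
    x ∈ edgeSites e ↔ ∃ z b, cr z b e ∧ (x = z ∨ x = z + stp b) := by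
  rcases e with ⟨⟨c, d⟩, ⟨f, g⟩⟩
  rcases x with ⟨p, q⟩
  constructor
  · intro h
    simp only [edgeSites, Set.mem_ofPred_eq, Prod.mk.injEq] at h
    rcases h with h | h | h | h
    · refine ⟨(f, g), false, ?_, ?_⟩ <;> simp [cr, dlo, stp] <;> omega
    · refine ⟨(c, d), false, ?_, ?_⟩ <;> simp [cr, dlo, stp] <;> omega
    · refine ⟨(f, g), true, ?_, ?_⟩ <;> simp [cr, dlo, stp] <;> omega
    · refine ⟨(c, d), true, ?_, ?_⟩ <;> simp [cr, dlo, stp] <;> omega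
  · rintro ⟨⟨z1, z2⟩, b, h1, h2⟩
    simp only [edgeSites, Set.mem_ofPred_eq, Prod.mk.injEq]
    rcases h1 with h1 | h1 <;> rcases h2 with h2 | h2 <;> cases b <;>
      simp [dlo, stp] at h1 h2 <;> omega

theorem dir4 {l : List DualV} (hl : PreC l) {i : ℕ} (hi : i < l.length) {d : DualV}
    (h : (cEdge l i).1 = d ∨ (cEdge l i).2 = d) :
    (dirFrom d (cEdge l i) = (1, 0) ∧ hasB l (d.1 + 1, d.2) true) ∨
    (dirFrom d (cEdge l i) = (-1, 0) ∧ hasB l d true) ∨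
    (dirFrom d (cEdge l i) = (0, 1) ∧ hasB l (d.1, d.2 + 1) false) ∨
    (dirFrom d (cEdge l i) = (0, -1) ∧ hasB l d false) := by
  have hadj : SiteAdj (cEdge l i).1 (cEdge l i).2 := hl.2.1 i hi
  have hb : ∀ z b, cr z b (cEdge l i) → hasB l z b := fun z b h => ⟨i, hi, h⟩
  rcases d with ⟨a, c⟩
  generalize cEdge l i = e at *
  rcases e with ⟨⟨e1, e2⟩, ⟨f1, f2⟩⟩
  rcases adj_cases hadj with h1 | h1 | h1 | h1 <;>
    (simp only [Prod.mk.injEq] at h1; obtain ⟨rfl, rfl⟩ := h1) <;>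
    rcases h with h | h <;> (simp only [Prod.mk.injEq] at h; obtain ⟨rfl, rfl⟩ := h)
  · left; exact ⟨by simp [dirFrom], hb _ _ (by simp [cr, dlo])⟩
  · right; left; exact ⟨by simp [dirFrom], hb _ _ (by simp [cr, dlo])⟩
  · right; left; exact ⟨by simp [dirFrom], hb _ _ (by simp [cr, dlo])⟩
  · left; exact ⟨(by simp [dirFrom]; intro h; omega), hb _ _ (by simp [cr, dlo])⟩
  · right; right; left; exact ⟨by simp [dirFrom], hb _ _ (by simp [cr, dlo])⟩
  · right; right; right; exact ⟨by simp [dirFrom], hb _ _ (by simp [cr, dlo])⟩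
  · right; right; right; exact ⟨by simp [dirFrom], hb _ _ (by simp [cr, dlo])⟩
  · right; right; left; exact ⟨(by simp [dirFrom]; intro h; omega), hb _ _ (by simp [cr, dlo])⟩

theorem meet_sub {l : List DualV} (hl : PreC l) {d : DualV} (h : nonLinkedMeet l d) :
    (hasB l (d.1 + 1, d.2) true ∨ hasB l d false) ∧ (hasB l d true ∨ hasB l (d.1, d.2 + 1) false) := by
  obtain ⟨i, hi, j, hj, h1, h2, -, -, h3⟩ := h
  rcases dir4 hl hi h1 with ⟨e1, b1⟩ | ⟨e1, b1⟩ | ⟨e1, b1⟩ | ⟨e1, b1⟩ <;>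
  rcases dir4 hl hj h2 with ⟨e2, b2⟩ | ⟨e2, b2⟩ | ⟨e2, b2⟩ | ⟨e2, b2⟩ <;>
  rw [e1, e2] at h3 <;> first | (exfalso; norm_num at h3; done) | tauto

theorem meet_EN {l : List DualV} {d : DualV} (h1 : hasB l (d.1 + 1, d.2) true)
    (h2 : hasB l (d.1, d.2 + 1) false) : nonLinkedMeet l d := by
  obtain ⟨i, hi, hc⟩ := h1
  obtain ⟨j, hj, hc'⟩ := h2
  refine ⟨i, hi, j, hj, ?_⟩
  generalize cEdge l i = e at *
  generalize cEdge l j = e' at *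
  rcases d with ⟨a, c⟩
  rcases hc with rfl | rfl <;> rcases hc' with rfl | rfl <;> simp [dlo, dirFrom]

theorem meet_SW {l : List DualV} {d : DualV} (h1 : hasB l d false)
    (h2 : hasB l d true) : nonLinkedMeet l d := by
  obtain ⟨i, hi, hc⟩ := h1
  obtain ⟨j, hj, hc'⟩ := h2
  refine ⟨i, hi, j, hj, ?_⟩
  generalize cEdge l i = e at *
  generalize cEdge l j = e' at *
  rcases d with ⟨a, c⟩
  rcases hc with rfl | rfl <;> rcases hc' with rfl | rfl <;> simp [dlo, dirFrom]

theorem PreC.mem_cDelta {l : List DualV} (hl : PreC l) {x : Site} :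
    x ∈ cDelta l ↔ ∃ y, Tri x y ∧ ¬ (inContour l x ↔ inContour l y) := by
  have kh : ∀ a b : ℤ, hasB l (a, b) false ↔ ¬ (inContour l (a, b) ↔ inContour l (a + 1, b)) := by
    intro a b
    have := hl.key (a, b) false
    simpa [stp] using this
  have kv : ∀ a b : ℤ, hasB l (a, b) true ↔ ¬ (inContour l (a, b) ↔ inContour l (a, b + 1)) := by
    intro a b
    have := hl.key (a, b) true
    simpa [stp] using this
  constructor
  · rintro (⟨i, hi, hx⟩ | ⟨⟨a, c⟩, hd, hx⟩)
    · obtain ⟨⟨a, c⟩, b, hc, hx⟩ := mem_edgeSites.1 hx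
      have hB : hasB l (a, c) b := ⟨i, hi, hc⟩
      cases b
      · rw [kh] at hB
        rcases hx with rfl | rfl
        · exact ⟨(a + 1, c), by simp [Tri], hB⟩
        · exact ⟨(a, c), by simp [Tri, stp], by simp only [stp]; simpa using fun h => hB h.symm⟩
      · rw [kv] at hB
        rcases hx with rfl | rfl
        · exact ⟨(a, c + 1), by simp [Tri], hB⟩
        · exact ⟨(a, c), by simp [Tri, stp], by simp only [stp]; simpa using fun h => hB h.symm⟩
    · have hm := meet_sub hl hd
      simp only at hm hx
      rw [kh, kh, kv, kv] at hm
      by_contra hcon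
      push Not at hcon
      rcases hx with rfl | rfl | rfl | rfl
      · have h1 := hcon (a + 1, c) (by simp [Tri])
        have h2 := hcon (a, c + 1) (by simp [Tri])
        have h3 := hcon (a + 1, c + 1) (by simp [Tri])
        tauto
      · have h1 := hcon (a, c) (by simp [Tri])
        have h3 := hcon (a + 1, c + 1) (by simp [Tri])
        tauto
      · have h1 := hcon (a, c) (by simp [Tri])
        have h3 := hcon (a + 1, c + 1) (by simp [Tri])
        tauto
      · have h1 := hcon (a, c) (by simp [Tri])
        have h2 := hcon (a, c + 1) (by simp [Tri])
        have h3 := hcon (a + 1, c) (by simp [Tri])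
        tauto
  · rintro ⟨y, hT, hy⟩
    have he : ∀ z b, hasB l z b → (x = z ∨ x = z + stp b) → x ∈ cDelta l := by
      rintro z b ⟨i, hi, hc⟩ hx
      exact Or.inl ⟨i, hi, mem_edgeSites.2 ⟨z, b, hc, hx⟩⟩
    rcases x with ⟨a, c⟩
    have r1 : hasB l (a, c) false → (a, c) ∈ cDelta l := fun h => he _ _ h (Or.inl rfl)
    have r2 : hasB l (a - 1, c) false → (a, c) ∈ cDelta l := fun h =>
      he _ _ h (Or.inr (by simp [stp]))
    have r3 : hasB l (a, c) true → (a, c) ∈ cDelta l := fun h => he _ _ h (Or.inl rfl)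
    have r4 : hasB l (a, c - 1) true → (a, c) ∈ cDelta l := fun h =>
      he _ _ h (Or.inr (by simp [stp]))
    have r5 : hasB l (a + 1, c) true → hasB l (a, c + 1) false → (a, c) ∈ cDelta l := fun h1 h2 =>
      Or.inr ⟨(a, c), meet_EN h1 h2, by simp⟩
    have r6 : hasB l (a - 1, c - 1) false → hasB l (a - 1, c - 1) true → (a, c) ∈ cDelta l :=
      fun h1 h2 => Or.inr ⟨(a - 1, c - 1), meet_SW h1 h2, by simp⟩
    rw [kh] at r1 r2 r6
    rw [kv] at r3 r4 r5 r6
    rw [kh] at r5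
    simp only [sub_add_cancel] at r2 r4 r6
    by_contra hn
    have s1 : inContour l (a, c) ↔ inContour l (a + 1, c) := by_contra fun h => hn (r1 h)
    have s2 : inContour l (a - 1, c) ↔ inContour l (a, c) := by_contra fun h => hn (r2 h)
    have s3 : inContour l (a, c) ↔ inContour l (a, c + 1) := by_contra fun h => hn (r3 h)
    have s4 : inContour l (a, c - 1) ↔ inContour l (a, c) := by_contra fun h => hn (r4 h)
    rcases hT with rfl | rfl | rfl | rfl | rfl | rfl <;> simp only at hy
    · exact hy s1
    · exact hy s2.symm
    · exact hy s3
    · exact hy s4.symm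
    · exact hn (r5 (by rw [← s1]; exact hy) (by rw [← s3]; exact hy))
    · exact hn (r6 (by rw [s4]; exact fun h => hy h.symm) (by rw [s2]; exact fun h => hy h.symm))

/-- Sites next to the contour. -/
def Nn (l : List DualV) (z : Site) : Prop := ∃ w b, hasB l w b ∧ (z = w ∨ z = w + stp b)

/-- Deep interior. -/
def deep (l : List DualV) : Finset Site := (intr l).filter (fun z => ¬ Nn l z)

theorem Nn.delta {l : List DualV} {z : Site} (h : Nn l z) : z ∈ cDelta l := by
  obtain ⟨w, b, ⟨i, hi, hc⟩, hz⟩ := h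
  exact Or.inl ⟨i, hi, mem_edgeSites.2 ⟨w, b, hc, hz⟩⟩

theorem step_status {l : List DualV} (X : Finset Site)
    (hX : ∀ z b, z ∉ deep l → z + stp b ∉ deep l → (z ∈ X ↔ z + stp b ∈ X))
    {z z' : Site} {b b' : Bool} {u v w : DualV} (h1 : cr z b (u, v)) (h2 : cr z' b' (v, w))
    (hz : hasB l z b) (hz' : hasB l z' b') : z ∈ X ↔ z' ∈ X := by
  have hn : ∀ y, Nn l y → y ∉ deep l := fun y hy h => (Finset.mem_filter.1 h).2 hy
  have n1 : z ∉ deep l := hn _ ⟨z, b, hz, Or.inl rfl⟩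
  have n2 : z + stp b ∉ deep l := hn _ ⟨z, b, hz, Or.inr rfl⟩
  have n3 : z' ∉ deep l := hn _ ⟨z', b', hz', Or.inl rfl⟩
  have n4 : z' + stp b' ∉ deep l := hn _ ⟨z', b', hz', Or.inr rfl⟩
  clear hz hz' hn
  rcases v with ⟨a, c⟩
  have e1 := hX (a, c) false
  have e2 := hX (a, c) true
  have e3 := hX (a + 1, c) true
  have e4 := hX (a, c + 1) false
  simp only [stp, Prod.mk_add_mk, if_true, if_false, Bool.false_eq_true, add_zero] at e1 e2 e3 e4
  have key : ∀ (z : Site) b u, (cr z b (u, (a, c)) ∨ cr z b ((a, c), u)) →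
      (z = (a, c) ∧ b = false) ∨ (z = (a, c) ∧ b = true) ∨ (z = (a + 1, c) ∧ b = true) ∨
        (z = (a, c + 1) ∧ b = false) := by
    rintro ⟨z1, z2⟩ b ⟨u1, u2⟩ h
    cases b <;> simp [cr, dlo] at h ⊢ <;> omega
  have k1 := key z b u (Or.inl h1)
  have k2 := key z' b' w (Or.inr h2)
  clear key h1 h2
  rcases k1 with ⟨rfl, rfl⟩ | ⟨rfl, rfl⟩ | ⟨rfl, rfl⟩ | ⟨rfl, rfl⟩ <;>
  rcases k2 with ⟨rfl, rfl⟩ | ⟨rfl, rfl⟩ | ⟨rfl, rfl⟩ | ⟨rfl, rfl⟩ <;>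
  simp only [stp, Prod.mk_add_mk, if_true, if_false, Bool.false_eq_true, add_zero] at n1 n2 n3 n4 <;>
  grind

theorem PreC.deep_SC {l : List DualV} (hl : PreC l) : SC (deep l) := by
  intro X hX
  have hn : ∀ y, Nn l y → y ∉ deep l := fun y hy h => (Finset.mem_filter.1 h).2 hy
  have hnV : ∀ y, y ∉ intr l → y ∉ deep l := fun y hy h => hy (Finset.mem_filter.1 h).1
  have hpos : 0 < l.length := List.length_pos_iff.2 hl.1
  obtain ⟨σ, hσ⟩ : ∃ σ : Prop, ∀ z, Nn l z → (z ∈ X ↔ σ) := by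
    obtain ⟨z0, b0, h0⟩ := cr_exists (e := cEdge l 0) (hl.2.1 0 hpos)
    refine ⟨z0 ∈ X, ?_⟩
    have h1 : ∀ i < l.length, ∀ z b, cr z b (cEdge l i) → (z ∈ X ↔ z0 ∈ X) := by
      intro i
      induction i with
      | zero =>
        intro _ z b hc
        rw [(cr_swap hc h0).1]
      | succ i ih =>
        intro hi z b hc
        have hi' : i < l.length := by omega
        obtain ⟨z1, b1, h1⟩ := cr_exists (e := cEdge l i) (hl.2.1 i hi')
        rw [← ih hi' z1 b1 h1]
        exact (step_status X hX h1 hc ⟨i, hi', h1⟩ ⟨i + 1, hi, hc⟩).symm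
    rintro z ⟨w, b, ⟨i, hi, hc⟩, hz⟩
    have h2 := h1 i hi w b hc
    rcases hz with rfl | rfl
    · exact h2
    · rw [← h2]
      exact (hX w b (hn _ ⟨w, b, ⟨i, hi, hc⟩, Or.inl rfl⟩)
        (hn _ ⟨w, b, ⟨i, hi, hc⟩, Or.inr rfl⟩)).symm
  have hcross : ∀ z, (¬ (z ∈ intr l ↔ z + stp false ∈ intr l)) → Nn l z ∧ Nn l (z + stp false) := by
    intro z hz
    rw [hl.mem_intr, hl.mem_intr, ← hl.key] at hz
    exact ⟨⟨z, false, hz, Or.inl rfl⟩, ⟨z, false, hz, Or.inr rfl⟩⟩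
  have hnσ : ¬ σ := by
    intro hs
    have hne : (X.filter (fun z => z ∉ deep l)).Nonempty := by
      obtain ⟨z0, b0, h0⟩ := cr_exists (e := cEdge l 0) (hl.2.1 0 hpos)
      have hz : Nn l z0 := ⟨z0, b0, ⟨0, hpos, h0⟩, Or.inl rfl⟩
      exact ⟨z0, Finset.mem_filter.2 ⟨(hσ z0 hz).2 hs, hn _ hz⟩⟩
    obtain ⟨r, hr, hmax⟩ := Finset.exists_max_image _ (fun z : Site => z.1) hne
    rw [Finset.mem_filter] at hr
    by_cases h1 : r + stp false ∈ intr l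
    · obtain ⟨k, hk1, hk2⟩ := exit_pos (intr l) (r + stp false) h1 (stp false) (by simp [stp])
      have hk3 := hk1 k le_rfl
      have e : r + stp false + ((k : ℤ) + 1) • stp false =
          r + stp false + (k : ℤ) • stp false + stp false := by rw [add_smul, one_smul, add_assoc]; simp only [add_assoc]
      rw [e] at hk2
      have h2 := (hcross _ (by tauto : ¬ (r + stp false + (k : ℤ) • stp false ∈ intr l ↔
        r + stp false + (k : ℤ) • stp false + stp false ∈ intr l))).2
      have h3 := hmax _ (Finset.mem_filter.2 ⟨(hσ _ h2).2 hs, hn _ h2⟩)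
      simp [stp] at h3
      try omega
    · have h2 := (hX r false hr.2 (hnV _ h1)).1 hr.1
      have h3 := hmax _ (Finset.mem_filter.2 ⟨h2, hnV _ h1⟩)
      simp [stp] at h3
      try omega
  have hXV : ∀ z ∈ X, z ∈ intr l := by
    by_contra hcon
    push Not at hcon
    have hne : (X.filter (fun z => z ∉ intr l)).Nonempty := by
      obtain ⟨z, h1, h2⟩ := hcon
      exact ⟨z, Finset.mem_filter.2 ⟨h1, h2⟩⟩
    obtain ⟨r, hr, hmax⟩ := Finset.exists_max_image _ (fun z : Site => z.1) hne
    rw [Finset.mem_filter] at hr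
    by_cases h1 : r + stp false ∈ intr l
    · exact hnσ ((hσ r (hcross r (by tauto)).1).1 hr.1)
    · have h2 := (hX r false (hnV _ hr.2) (hnV _ h1)).1 hr.1
      have h3 := hmax _ (Finset.mem_filter.2 ⟨h2, h1⟩)
      simp [stp] at h3
      try omega
  intro z hz
  exact Finset.mem_filter.2 ⟨hXV z hz, fun hN => hnσ ((hσ z hN).1 hz)⟩

/-! ### Part 6: peeling off contours -/

theorem PreC.bd_delta {l : List DualV} (hl : PreC l) {p : Site × Bool} (hp : p ∈ bd (intr l)) :
    p.1 ∈ cDelta l ∧ p.1 + stp p.2 ∈ cDelta l := by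
  have h : hasB l p.1 p.2 := hl.mem_bd_intr.1 hp
  exact ⟨Nn.delta ⟨p.1, p.2, h, Or.inl rfl⟩, Nn.delta ⟨p.1, p.2, h, Or.inr rfl⟩⟩

theorem Hm_split {l : List DualV} (hl : PreC l) {L : ℕ} (hV : intr l ⊆ box L) (h c : ℤ) (hc : 0 ≤ c)
    (ζ f : Config) (h1 : ∀ z ∈ intr l, ζ z = h) (h2 : ∀ z ∉ intr l, f z = 0)
    (h3 : ∀ z ∉ intr l, z ∈ cDelta l → ζ z ≤ h) (h4 : ∀ z ∈ intr l, z ∈ cDelta l → 0 ≤ f z) :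
    Hm L (fun z => ζ z + f z + c * ind (intr l) z) = Hm L ζ + Hm L f + c * (bd (intr l)).card := by
  rw [← sum_ind_bd (bd_sub_Ed hV)]
  unfold Hm
  rw [Finset.mul_sum, ← Finset.sum_add_distrib, ← Finset.sum_add_distrib]
  refine Finset.sum_congr rfl fun p _ => ?_
  by_cases hp : p ∈ bd (intr l)
  · obtain ⟨d1, d2⟩ := hl.bd_delta hp
    rw [if_pos hp]
    rw [mem_bd] at hp
    by_cases hz : p.1 ∈ intr l
    · have hw : p.1 + stp p.2 ∉ intr l := by tauto
      have a1 := h1 _ hz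
      have a2 := h2 _ hw
      have a3 := h3 _ hw d2
      have a4 := h4 _ hz d1
      simp only [ind, hz, hw, if_true, if_false]
      rw [a1, a2, abs_of_nonneg (by omega), abs_of_nonneg (by omega), abs_of_nonneg (by omega)]
      ring
    · have hw : p.1 + stp p.2 ∈ intr l := by tauto
      have a1 := h1 _ hw
      have a2 := h2 _ hz
      have a3 := h3 _ hz d1
      have a4 := h4 _ hw d2
      simp only [ind, hz, hw, if_true, if_false]
      rw [a1, a2, abs_of_nonpos (by omega), abs_of_nonpos (by omega), abs_of_nonpos (by omega)]
      ring
  · rw [if_neg hp]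
    rw [mem_bd, not_not] at hp
    by_cases hz : p.1 ∈ intr l
    · have hw := hp.1 hz
      simp only [ind, hz, hw, if_true]
      rw [h1 _ hz, h1 _ hw]
      simp
    · have hw : p.1 + stp p.2 ∉ intr l := fun h => hz (hp.2 h)
      simp only [ind, hz, hw, if_false]
      rw [h2 _ hz, h2 _ hw]
      simp

/-- The boundary layer. -/
def lay (l : List DualV) : Finset Site := (intr l).filter (fun z => z ∈ cDelta l)

/-- All configurations. -/
def Om (L np : ℕ) : Finset Config := cfg (box L) (fun _ => 0) (fun _ => (np : ℤ))

theorem peel : ∃ C : ℝ, 0 < C ∧ ∀ β : ℝ, 1 ≤ β → ∀ (L np : ℕ) (l : List DualV), PreC l →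
    intr l ⊆ box L → ∀ (h : ℕ) (E E' : Finset Config),
    (∀ η ∈ E, η ∈ Om L np ∧ η ∈ hContourEvent l ((h : ℤ) + 1)) →
    (∀ η ∈ E, ∀ f ∈ cfg (intr l) (flo (lay l) h) (fun _ => (np : ℤ) - h),
      (fun z => if z ∈ intr l then (h : ℤ) + f z else η z) ∈ E') →
    Zs β L E ≤ Real.exp (-β * (cLen l : ℝ) +
        C * (cArea l : ℝ) * Real.exp (-(4 * β * (h + 1 : ℕ)))) * Zs β L E' := by
  obtain ⟨C, hC, hr⟩ := ratio
  refine ⟨C, hC, ?_⟩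
  intro β hβ L np l hl hVL h E E' hE hE'
  set V := intr l with hVdef
  have hmV : ∀ z, z ∈ V ↔ inContour l z := fun z => hl.mem_intr
  have hr := hr β hβ L V (deep l) (lay l) hVL (Finset.filter_subset _ _) hl.deep_SC
    (by
      intro x hx hx0
      have hN : Nn l x := by
        by_contra hN
        exact hx0 (Finset.mem_filter.2 ⟨hx, hN⟩)
      exact Finset.mem_filter.2 ⟨hx, hN.delta⟩) h ((np : ℤ) - h - 1)
  rw [sub_add_cancel] at hr
  set F := cfg V (flo (lay l) (h + 1)) (fun _ => (np : ℤ) - h - 1) with hF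
  set F' := cfg V (flo (lay l) h) (fun _ => (np : ℤ) - h) with hF'
  let ζ : Config → Config := fun η z => if z ∈ V then (h : ℤ) else η z
  let φ : Config → Config := fun η z => if z ∈ V then η z - (h + 1) else 0
  have hminus : ∀ η ∈ E, ∀ z ∉ V, z ∈ cDelta l → η z ≤ h := by
    intro η hη z hz hd
    have := (hE η hη).2.1 z ⟨hd, fun h => hz ((hmV z).2 h)⟩
    omega
  have hplus : ∀ η ∈ E, ∀ z ∈ V, z ∈ cDelta l → (h : ℤ) + 1 ≤ η z := by
    intro η hη z hz hd
    exact (hE η hη).2.2 z ⟨hd, (hmV z).1 hz⟩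
  have hφ : ∀ η ∈ E, φ η ∈ F := by
    intro η hη
    have hO := mem_cfg.1 (hE η hη).1
    rw [hF, mem_cfg]
    refine ⟨fun z hz => ?_, fun z hz => by simp [φ, hz]⟩
    have h1 := hO.1 z (hVL hz)
    simp only [φ, hz, if_true]
    unfold flo
    split_ifs with hlay
    · have := hplus η hη z hz (Finset.mem_filter.1 hlay).2
      omega
    · push_cast
      omega
  have hwt : ∀ η ∈ E, wt β L η = Real.exp (-β * (bd V).card) * (wt β L (ζ η) * wt β L (φ η)) := by
    intro η hη
    have hs := Hm_split hl hVL h 1 (by norm_num) (ζ η) (φ η) (fun z hz => by simp [ζ, V, hz])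
      (fun z hz => by simp [φ, V, hz])
      (fun z hz hd => by
        have := hminus η hη z hz hd
        simp only [ζ]
        rw [if_neg hz]
        exact this)
      (fun z hz hd => by
        have := hplus η hη z hz hd
        simp only [φ]
        rw [if_pos hz]
        omega)
    have he : (fun z => ζ η z + φ η z + 1 * ind (intr l) z) = η := by
      funext z
      by_cases hz : z ∈ V
      · have hz' : z ∈ intr l := hz
        simp only [ζ, φ, ind, hz, hz', if_true]; ring
      · have hz' : z ∉ intr l := hz
        simp only [ζ, φ, ind, hz, hz', if_false]; ring
    rw [he] at hs
    unfold wt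
    rw [hs, ← Real.exp_add, ← Real.exp_add]
    congr 1
    push_cast
    ring
  set P := E.image ζ with hP
  have hup : Zs β L E ≤ Real.exp (-β * (bd V).card) * (Zs β L P * Zs β L F) := by
    have h1 : Zs β L E = Real.exp (-β * (bd V).card) *
        ∑ η ∈ E, (fun q : Config × Config => wt β L q.1 * wt β L q.2) (ζ η, φ η) := by
      rw [Finset.mul_sum]
      exact Finset.sum_congr rfl hwt
    rw [h1]
    refine mul_le_mul_of_nonneg_left ?_ (Real.exp_pos _).le
    rw [← Finset.sum_image (g := fun η => (ζ η, φ η))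
      (f := fun q : Config × Config => wt β L q.1 * wt β L q.2) (s := E)]
    · unfold Zs
      rw [Finset.sum_mul_sum, ← Finset.sum_product']
      refine Finset.sum_le_sum_of_subset_of_nonneg ?_ fun q _ _ =>
        mul_nonneg (wt_pos _ _ _).le (wt_pos _ _ _).le
      intro q hq
      obtain ⟨η, hη, rfl⟩ := Finset.mem_image.1 hq
      exact Finset.mem_product.2 ⟨Finset.mem_image_of_mem _ hη, hφ η hη⟩
    · intro a _ b _ hab
      obtain ⟨e1, e2⟩ := Prod.mk.inj hab
      funext z
      by_cases hz : z ∈ V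
      · have := congrFun e2 z
        simp only [φ, hz, if_true] at this
        omega
      · have := congrFun e1 z
        simpa only [ζ, hz, if_false] using this
  have hlow : Zs β L P * Zs β L F' ≤ Zs β L E' := by
    have hPV : ∀ ζ' ∈ P, ∀ z ∈ V, ζ' z = h := by
      intro ζ' hζ z hz
      obtain ⟨η, hη, rfl⟩ := Finset.mem_image.1 hζ
      simp [ζ, hz]
    have h1 : Zs β L P * Zs β L F' = ∑ q ∈ P ×ˢ F', wt β L (q.1 + q.2) := by
      unfold Zs
      rw [Finset.sum_mul_sum, ← Finset.sum_product']
      refine Finset.sum_congr rfl fun q hq => ?_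
      obtain ⟨hq1, hq2⟩ := Finset.mem_product.1 hq
      have hq2' := mem_cfg.1 hq2
      have hs := Hm_split hl hVL h 0 le_rfl q.1 q.2 (hPV _ hq1) hq2'.2
        (fun z hz hd => by
          obtain ⟨η, hη, he⟩ := Finset.mem_image.1 hq1
          have := hminus η hη z hz hd
          rw [← he]
          simp only [ζ]
          rw [if_neg hz]
          exact this)
        (fun z hz hd => by
          have := (hq2'.1 z hz).1
          unfold flo at this
          rwa [if_pos (show z ∈ lay l from Finset.mem_filter.2 ⟨hz, hd⟩)] at this)
      have he : (fun z => q.1 z + q.2 z + 0 * ind (intr l) z) = q.1 + q.2 := by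
        funext z; simp
      rw [he] at hs
      unfold wt
      rw [hs, ← Real.exp_add]
      congr 1
      push_cast
      ring
    rw [h1, ← Finset.sum_image (g := fun q : Config × Config => q.1 + q.2) (f := wt β L)]
    · refine Zs_mono β L ?_
      intro c hc
      obtain ⟨q, hq, rfl⟩ := Finset.mem_image.1 hc
      obtain ⟨hq1, hq2⟩ := Finset.mem_product.1 hq
      obtain ⟨η, hη, he⟩ := Finset.mem_image.1 hq1
      have := hE' η hη q.2 hq2
      convert this using 1
      funext z
      by_cases hz : z ∈ V
      · simp [← he, ζ, hz]
      · simp [← he, ζ, hz, (mem_cfg.1 hq2).2 z hz]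
    · intro a ha b hb hab
      obtain ⟨ha1, ha2⟩ := Finset.mem_product.1 ha
      obtain ⟨hb1, hb2⟩ := Finset.mem_product.1 hb
      have e : a.2 = b.2 := by
        funext z
        by_cases hz : z ∈ V
        · have := congrFun hab z
          simp only [Pi.add_apply] at this
          rw [hPV _ ha1 z hz, hPV _ hb1 z hz] at this
          omega
        · rw [(mem_cfg.1 ha2).2 z hz, (mem_cfg.1 hb2).2 z hz]
      refine Prod.ext ?_ e
      simp only [e] at hab
      exact add_right_cancel hab
  have hlen : (cLen l : ℝ) ≤ (bd V).card := by exact_mod_cast hl.len_le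
  have harea : (cArea l : ℝ) = V.card := rfl
  have hP0 : 0 ≤ Zs β L P := Zs_nonneg _ _ _
  rw [Real.exp_add, harea]
  set R := Real.exp (C * V.card * Real.exp (-(4 * β * (h + 1 : ℕ))))
  have hR : 0 < R := Real.exp_pos _
  have hlen2 : Real.exp (-β * (bd V).card) ≤ Real.exp (-β * (cLen l : ℝ)) := by
    rw [Real.exp_le_exp]; nlinarith
  calc Zs β L E ≤ Real.exp (-β * (bd V).card) * (Zs β L P * Zs β L F) := hup
    _ ≤ Real.exp (-β * (bd V).card) * (Zs β L P * (R * Zs β L F')) := by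
        refine mul_le_mul_of_nonneg_left ?_ (Real.exp_pos _).le
        exact mul_le_mul_of_nonneg_left hr hP0
    _ = Real.exp (-β * (bd V).card) * (R * (Zs β L P * Zs β L F')) := by ring
    _ ≤ Real.exp (-β * (bd V).card) * (R * Zs β L E') := by
        refine mul_le_mul_of_nonneg_left ?_ (Real.exp_pos _).le
        exact mul_le_mul_of_nonneg_left hlow hR.le
    _ ≤ Real.exp (-β * (cLen l : ℝ)) * (R * Zs β L E') :=
        mul_le_mul_of_nonneg_right hlen2 (mul_nonneg hR.le (Zs_nonneg _ _ _))
    _ = _ := by ring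

/-- The event restricted to a subfamily. -/
def Ev (L np : ℕ) {N : ℕ} (γ : Fin N → List DualV) (hs : Fin N → ℤ) (S : Finset (Fin N)) :
    Finset Config := (Om L np).filter (fun η => ∀ s ∈ S, η ∈ hContourEvent (γ s) (hs s))

theorem nest_iter {N : ℕ} (γ : Fin N → List DualV) (hs : Fin N → ℤ) (S : Finset (Fin N))
    (hnest : ∀ i : ℤ, 1 ≤ i → ∀ x : Site, (∃ s ∈ S, hs s = i + 1 ∧ inContour (γ s) x) →
      ∃ s ∈ S, hs s = i ∧ inContour (γ s) x) (x : Site) (j : ℤ) (hj : 1 ≤ j) :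
    ∀ k : ℕ, (∃ s ∈ S, hs s = j + k ∧ inContour (γ s) x) →
      ∃ s ∈ S, hs s = j ∧ inContour (γ s) x := by
  intro k
  induction k with
  | zero => intro h; simpa using h
  | succ k ih =>
    intro h
    apply ih
    refine hnest (j + k) (by omega) x ?_
    obtain ⟨s, h1, h2, h3⟩ := h
    exact ⟨s, h1, by push_cast at h2; omega, h3⟩

theorem family : ∃ C : ℝ, 0 < C ∧ ∀ β : ℝ, 1 ≤ β → ∀ (L np N : ℕ) (γ : Fin N → List DualV)
    (hs : Fin N → ℤ), (∀ s, PreC (γ s)) → (∀ s, intr (γ s) ⊆ box L) → (∀ s, 1 ≤ hs s) →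
    (∀ s s', s ≠ s' → hs s = hs s' → ∀ x : Site, ¬ (inContour (γ s) x ∧ inContour (γ s') x)) →
    ∀ (n : ℕ) (S : Finset (Fin N)), S.card = n →
    (∀ i : ℤ, 1 ≤ i → ∀ x : Site, (∃ s ∈ S, hs s = i + 1 ∧ inContour (γ s) x) →
      ∃ s ∈ S, hs s = i ∧ inContour (γ s) x) →
    Zs β L (Ev L np γ hs S) ≤ Real.exp (∑ s ∈ S, (-β * (cLen (γ s) : ℝ) +
              C * (cArea (γ s) : ℝ) * Real.exp (-(4 * β * (hs s : ℝ))))) * Zs β L (Om L np) := by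
  obtain ⟨C, hC, hpeel⟩ := peel
  refine ⟨C, hC, ?_⟩
  intro β hβ L np N γ hs hpre hbox hpos hdisj n
  induction n with
  | zero =>
    intro S hS _
    rw [Finset.card_eq_zero] at hS
    subst hS
    simp only [Finset.sum_empty, Real.exp_zero, one_mul]
    exact Zs_mono β L (Finset.filter_subset _ _)
  | succ n ih =>
    intro S hS hnest
    by_cases hne : (Ev L np γ hs S) = ∅
    · rw [hne]
      have : Zs β L ∅ = 0 := by simp [Zs]
      rw [this]
      exact mul_nonneg (Real.exp_pos _).le (Zs_nonneg _ _ _)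
    obtain ⟨η0, hη0⟩ := Finset.nonempty_iff_ne_empty.2 hne
    have hη0 := (Finset.mem_filter.1 hη0).2
    have hSne : S.Nonempty := by rw [← Finset.card_pos]; omega
    obtain ⟨s, hsS, hmax⟩ := Finset.exists_max_image S hs hSne
    have hS' : (S.erase s).card = n := by rw [Finset.card_erase_of_mem hsS]; omega
    have ih := ih (S.erase s) hS' (by
      rintro i hi x ⟨t, ht, h1, h2⟩
      have htS := Finset.mem_of_mem_erase ht
      obtain ⟨t', ht', h3, h4⟩ := hnest i hi x ⟨t, htS, h1, h2⟩
      refine ⟨t', Finset.mem_erase.2 ⟨?_, ht'⟩, h3, h4⟩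
      rintro rfl
      have := hmax t htS
      omega)
    have hmV : ∀ t z, z ∈ intr (γ t) ↔ inContour (γ t) z := fun t z => (hpre t).mem_intr
    have hA : ∀ t ∈ S, t ≠ s → ∀ z ∈ cDeltaMinus (γ t), z ∉ intr (γ s) := by
      intro t ht hts z hz hzV
      rw [hmV] at hzV
      obtain ⟨hzd, hzn⟩ := hz
      obtain ⟨y, hT, hy⟩ := (hpre t).mem_cDelta.1 hzd
      have hyin : inContour (γ t) y := by_contra fun hn =>
        hy ⟨fun h => absurd h hzn, fun h => absurd h hn⟩
      have hle := hmax t ht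
      obtain ⟨t', ht', he, hin⟩ := nest_iter γ hs S hnest z (hs t) (hpos t) (hs s - hs t).toNat
        ⟨s, hsS, by omega, hzV⟩
      have hne' : t ≠ t' := by rintro rfl; exact hzn hin
      have hyn : ¬ inContour (γ t') y := fun h => hdisj t t' hne' he.symm y ⟨hyin, h⟩
      have hzd' : z ∈ cDelta (γ t') := (hpre t').mem_cDelta.2 ⟨y, hT, fun h => hyn (h.1 hin)⟩
      have h1 := (hη0 t' ht').2 z ⟨hzd', hin⟩
      have h2 := (hη0 t ht).1 z ⟨hzd, hzn⟩
      omega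
    have hB : ∀ t ∈ S, t ≠ s → ∀ z ∈ cDeltaPlus (γ t), z ∈ intr (γ s) →
        z ∈ lay (γ s) ∧ hs t ≤ hs s - 1 := by
      intro t ht hts z hz hzV
      obtain ⟨hzd, hzn⟩ := hz
      obtain ⟨y, hT, hy⟩ := (hpre t).mem_cDelta.1 hzd
      have hyn : ¬ inContour (γ t) y := fun hn => hy ⟨fun _ => hn, fun _ => hzn⟩
      have hyV := hA t ht hts y ⟨(hpre t).mem_cDelta.2 ⟨z, hT.symm, fun h => hyn (h.2 hzn)⟩, hyn⟩
      constructor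
      · refine Finset.mem_filter.2 ⟨hzV, (hpre s).mem_cDelta.2 ⟨y, hT, ?_⟩⟩
        rw [hmV] at hzV hyV
        exact fun h => hyV (h.1 hzV)
      · have hle := hmax t ht
        have : hs t ≠ hs s := fun he => hdisj t s hts he z ⟨hzn, (hmV s z).1 hzV⟩
        omega
    obtain ⟨h, hh⟩ : ∃ h : ℕ, hs s = (h : ℤ) + 1 := ⟨(hs s - 1).toNat, by have := hpos s; omega⟩
    have hp := hpeel β hβ L np (γ s) (hpre s) (hbox s) h (Ev L np γ hs S) (Ev L np γ hs (S.erase s))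
      (by
        intro η hη
        have := Finset.mem_filter.1 hη
        refine ⟨this.1, ?_⟩
        rw [← hh]
        exact this.2 s hsS)
      (by
        intro η hη f hf
        obtain ⟨hO, hη⟩ := Finset.mem_filter.1 hη
        have hO := mem_cfg.1 hO
        have hf := mem_cfg.1 hf
        refine Finset.mem_filter.2 ⟨?_, ?_⟩
        · unfold Om
          rw [mem_cfg]
          constructor
          · intro z hz
            by_cases hzV : z ∈ intr (γ s)
            · have h1 := hf.1 z hzV
              have h2 : -(h : ℤ) ≤ f z := by
                refine le_trans ?_ h1.1
                unfold flo
                split_ifs <;> omega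
              simp only [hzV, if_true]
              omega
            · simp only [hzV, if_false]
              exact hO.1 z hz
          · intro z hz
            have hzV : z ∉ intr (γ s) := fun h => hz (hbox s h)
            simp only [hzV, if_false]
            exact hO.2 z hz
        · intro t ht
          obtain ⟨hts, htS⟩ := Finset.mem_erase.1 ht
          constructor
          · intro z hz
            have hzV := hA t htS hts z hz
            simp only [hzV, if_false]
            exact (hη t htS).1 z hz
          · intro z hz
            by_cases hzV : z ∈ intr (γ s)
            · obtain ⟨h1, h2⟩ := hB t htS hts z hz hzV
              have h3 := (hf.1 z hzV).1
              unfold flo at h3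
              rw [if_pos h1] at h3
              simp only [hzV, if_true]
              omega
            · simp only [hzV, if_false]
              exact (hη t htS).2 z hz)
    refine hp.trans ?_
    have hcast : (((h + 1 : ℕ) : ℝ)) = (hs s : ℝ) := by rw [hh]; push_cast; ring
    rw [hcast]
    refine (mul_le_mul_of_nonneg_left ih (Real.exp_pos _).le).trans (le_of_eq ?_)
    rw [← mul_assoc, ← Real.exp_add, Finset.add_sum_erase S
      (fun s => -β * (cLen (γ s) : ℝ) +
        C * (cArea (γ s) : ℝ) * Real.exp (-(4 * β * (hs s : ℝ)))) hsS]

/-- Edge sharing weight. -/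
def ew (L : ℕ) (y : Site) : ℝ := if y ∈ box L then 1 / 2 else 1

theorem Hm_dir (L : ℕ) (η : Config) (hη : ∀ x ∉ box L, η x = 0) (b : Bool) :
    ∑ x ∈ Finset.Icc ((0 : ℤ), (0 : ℤ)) ((L : ℤ), (L : ℤ)), ((|η x - η (x + stp b)| : ℤ) : ℝ) =
    ∑ x ∈ box L, (((|η x - η (x + stp b)| : ℤ) : ℝ) * ew L (x + stp b) +
      ((|η x - η (x - stp b)| : ℤ) : ℝ) * ew L (x - stp b)) := by
  set G := Finset.Icc ((0 : ℤ), (0 : ℤ)) ((L : ℤ), (L : ℤ)) with hG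
  have hpt : ∀ x ∈ G, ((|η x - η (x + stp b)| : ℤ) : ℝ) =
      (if x ∈ box L then ((|η x - η (x + stp b)| : ℤ) : ℝ) * ew L (x + stp b) else 0) +
      (if x + stp b ∈ box L then ((|η x - η (x + stp b)| : ℤ) : ℝ) * ew L x else 0) := by
    intro x _
    unfold ew
    by_cases h1 : x ∈ box L <;> by_cases h2 : x + stp b ∈ box L
    · simp only [h1, h2, if_true]; ring
    · simp [h1, h2]
    · simp [h1, h2]
    · simp [h1, h2, hη x h1, hη _ h2]
  rw [Finset.sum_congr rfl hpt, Finset.sum_add_distrib, Finset.sum_add_distrib,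
    ← Finset.sum_filter, ← Finset.sum_filter]
  congr 1
  · apply Finset.sum_congr _ (fun _ _ => rfl)
    ext x
    simp only [hG, box, Finset.mem_filter, Finset.mem_Icc, Prod.le_def]
    constructor
    · exact fun h => h.2
    · intro h; refine ⟨?_, h⟩; constructor <;> constructor <;> omega
  · refine Finset.sum_bij (fun x _ => x + stp b) ?_ ?_ ?_ ?_
    · intro x hx; exact (Finset.mem_filter.1 hx).2
    · intro x _ y _ h; exact add_right_cancel h
    · intro y hy
      refine ⟨y - stp b, ?_, by simp⟩
      rw [Finset.mem_filter]
      refine ⟨?_, by simpa using hy⟩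
      simp only [hG, box, Finset.mem_Icc, Prod.le_def] at hy ⊢
      cases b <;> simp [stp] at hy ⊢ <;> omega
    · intro x _
      rw [add_sub_cancel_right, abs_sub_comm]

theorem sosH_eq (L : ℕ) (η : Config) (hη : ∀ x ∉ box L, η x = 0) :
    sosH (box L) 0 η = (Hm L η : ℝ) := by
  have h1 : sosH (box L) 0 η =
      ∑ x ∈ box L, ∑ y ∈ nbrs x, ((|η x - η y| : ℤ) : ℝ) * ew L y := by
    unfold sosH
    rw [Finset.mul_sum, ← Finset.sum_add_distrib]
    apply Finset.sum_congr rfl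
    intro x _
    rw [← Finset.sum_filter_add_sum_filter_not (nbrs x) (fun y => y ∈ box L), Finset.mul_sum]
    congr 1
    · apply Finset.sum_congr rfl
      intro y hy
      rw [ew, if_pos (Finset.mem_filter.1 hy).2, mul_comm]
    · apply Finset.sum_congr rfl
      intro y hy
      have := (Finset.mem_filter.1 hy).2
      rw [ew, if_neg this, mul_one, hη y this]; rfl
  have h2 : ∀ (x : Site) (f : Site → ℝ), ∑ y ∈ nbrs x, f y =
      (f (x + stp false) + f (x - stp false)) + (f (x + stp true) + f (x - stp true)) := by
    intro x f
    unfold nbrs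
    rw [Finset.sum_insert, Finset.sum_insert, Finset.sum_insert, Finset.sum_singleton]
    · have e1 : x + stp false = (x.1 + 1, x.2) := by ext <;> simp [stp]
      have e2 : x - stp false = (x.1 - 1, x.2) := by ext <;> simp [stp]
      have e3 : x + stp true = (x.1, x.2 + 1) := by ext <;> simp [stp]
      have e4 : x - stp true = (x.1, x.2 - 1) := by ext <;> simp [stp]
      rw [e1, e2, e3, e4]; ring
    · simp; omega
    · simp
    · simp; omega
  rw [h1]
  unfold Hm Ed
  push_cast
  rw [Finset.sum_product_right]
  have := Hm_dir L η hη true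
  have h4 := Hm_dir L η hη false
  push_cast at this h4
  rw [Fintype.sum_bool]
  dsimp only
  rw [this, h4, ← Finset.sum_add_distrib]
  apply Finset.sum_congr rfl
  intro x _
  rw [h2]
  push_cast
  ring

theorem tsum_Om (β : ℝ) (L np : ℕ) (A : Set Config) :
    ∑' g : {x // x ∈ box L} → ℤ, Set.indicator A
      (gWeight β (box L) 0 (Set.Icc 0 (np : ℤ)) (fun _ => 0)) (extendC (box L) 0 g) =
    Zs β L ((Om L np).filter (fun η => η ∈ A)) := by
  have hz : ∀ g : {x // x ∈ box L} → ℤ,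
      g ∉ Fintype.piFinset (fun _ : {x // x ∈ box L} => Finset.Icc (0 : ℤ) (np : ℤ)) →
      Set.indicator A (gWeight β (box L) 0 (Set.Icc 0 (np : ℤ)) (fun _ => 0))
        (extendC (box L) 0 g) = 0 := by
    intro g hg
    have : gWeight β (box L) 0 (Set.Icc 0 (np : ℤ)) (fun _ => 0) (extendC (box L) 0 g) = 0 := by
      unfold gWeight
      rw [if_neg]
      intro h
      apply hg
      rw [Fintype.mem_piFinset]
      intro a
      have := h a.1 a.2
      simp only [extendC, a.2, dif_pos] at this
      exact Finset.mem_Icc.2 this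
    by_cases h : extendC (box L) 0 g ∈ A
    · rw [Set.indicator_of_mem h, this]
    · rw [Set.indicator_of_notMem h]
  rw [tsum_eq_sum hz]
  unfold Zs
  rw [Finset.sum_filter]
  refine Finset.sum_bij (fun g _ => extendC (box L) 0 g) ?_ ?_ ?_ ?_
  · intro g hg
    rw [Om, mem_cfg]
    rw [Fintype.mem_piFinset] at hg
    constructor
    · intro x hx
      simp only [extendC, hx, dif_pos]
      exact Finset.mem_Icc.1 (hg ⟨x, hx⟩)
    · intro x hx
      simp [extendC, hx]
  · intro g _ g' _ h
    funext a
    have := congrFun h a.1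
    simpa [extendC, a.2] using this
  · intro η hη
    rw [Om, mem_cfg] at hη
    refine ⟨fun a => η a.1, ?_, ?_⟩
    · rw [Fintype.mem_piFinset]
      intro a
      exact Finset.mem_Icc.2 (hη.1 a.1 a.2)
    · funext x
      by_cases hx : x ∈ box L
      · simp [extendC, hx]
      · simp [extendC, hx, hη.2 x hx]
  · intro g hg
    rw [Fintype.mem_piFinset] at hg
    have h0 : ∀ x ∉ box L, extendC (box L) 0 g x = 0 := by
      intro x hx; simp [extendC, hx]
    have hw : gWeight β (box L) 0 (Set.Icc 0 (np : ℤ)) (fun _ => 0) (extendC (box L) 0 g) =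
        wt β L (extendC (box L) 0 g) := by
      unfold gWeight wt
      rw [if_pos, sosH_eq L _ h0, add_zero]
      intro x hx
      simp only [extendC, hx, dif_pos]
      exact Finset.mem_Icc.1 (hg ⟨x, hx⟩)
    by_cases h : extendC (box L) 0 g ∈ A
    · rw [Set.indicator_of_mem h, hw, if_pos h]
    · rw [Set.indicator_of_notMem h, if_neg h]

/-- Proposition 3.6, Eq. (3.6) of the paper. There is an absolute
constant `C₀ > 0` such that for all `β ≥ 1` the following holds. For any finite family
`{(γ_s, h_s)}` of contours in `Λ = {1,…,L}²` with heights `h_s ≥ 1` such that the union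
of interiors at level `i+1` is contained in the union of interiors at level `i`, and
interiors at equal levels are pairwise disjoint:
`π_Λ^0(∩_s C_{γ_s,h_s}) ≤ exp(Σ_s (−β|γ_s| + C₀|Λ_{γ_s}| e^{−4βh_s}))`. -/
theorem sos_contour_family_probability :
    ∃ C₀ : ℝ, 0 < C₀ ∧ ∀ β : ℝ, 1 ≤ β →
      ∀ L np : ℕ, Real.log L ≤ (np : ℝ) → (np : ℝ) ≤ (L : ℝ) →
        ∀ N : ℕ, ∀ γ : Fin N → List DualV, ∀ hs : Fin N → ℤ,
          (∀ s, IsContour (γ s)) →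
          (∀ s, ∀ x : Site, inContour (γ s) x → x ∈ box L) →
          (∀ s, 1 ≤ hs s) →
          (∀ i : ℤ, 1 ≤ i → ∀ x : Site,
            (∃ s, hs s = i + 1 ∧ inContour (γ s) x) →
              ∃ s, hs s = i ∧ inContour (γ s) x) →
          (∀ s s', s ≠ s' → hs s = hs s' →
            ∀ x : Site, ¬ (inContour (γ s) x ∧ inContour (γ s') x)) →
          gProb β (box L) 0 (Set.Icc 0 (np : ℤ)) (fun _ => 0)
              {η | ∀ s, η ∈ hContourEvent (γ s) (hs s)} ≤
            Real.exp (∑ s, (-β * (cLen (γ s) : ℝ) +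
              C₀ * (cArea (γ s) : ℝ) * Real.exp (-(4 * β * (hs s : ℝ))))) := by
  obtain ⟨C, hC, hfam⟩ := family
  refine ⟨C, hC, ?_⟩
  intro β hβ L np _ _ N γ hs hcon hbox hpos hnest hdisj
  have hmain := hfam β hβ L np N γ hs (fun s => (hcon s).pre)
    (fun s x hx => hbox s x ((hcon s).pre.mem_intr.1 hx)) hpos hdisj _ Finset.univ rfl
    (by simpa using hnest)
  unfold gProb
  have hnum := tsum_Om β L np {η | ∀ s, η ∈ hContourEvent (γ s) (hs s)}
  have hden := tsum_Om β L np Set.univ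
  simp only [Set.indicator_univ, Set.mem_univ, Finset.filter_true] at hden
  rw [hnum, hden]
  have hpos : 0 < Zs β L (Om L np) := by
    unfold Zs
    apply Finset.sum_pos (fun η _ => wt_pos β L η)
    refine ⟨fun _ => 0, ?_⟩
    rw [Om, mem_cfg]
    exact ⟨fun _ _ => ⟨le_refl _, by positivity⟩, fun _ _ => rfl⟩
  rw [div_le_iff₀ hpos]
  simpa [Ev] using hmain

end SOSPaper
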